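/- arXiv:math/9912125 — 2 statements merged into one kernel-verified Lean document; each statement's English description precedes it below -/
import Mathlib

section
/- Let u ∈ S_n and let x_u, x̃_u ∈ Y°_u. For x ∈ Y_{≥u}, let ρ_{x_u}(x) denote the unique element of x_u N(u) of the form [x n_-]_+ with n_- ∈ N_-(u) and x n_- ∈ G_0 (this element exists, is unique, and is totally nonnegative). Then ρ_{x_u} restricts to a bijection from the fiber {x ∈ Y_{≥u} : π_u(x) = x̃_u} onto the fiber {x ∈ Y_{≥u} : π_u(x) = x_u}, and for every w ∈ S_n with w ≥ u this bijection maps Y°_w ∩ {x : π_u(x) = x̃_u} onto Y°_w ∩ {x : π_u(x) = x_u}. -/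
open scoped Classical

namespace BruhatTNN

abbrev Mat (n : ℕ) := Matrix (Fin n) (Fin n) ℝ

/-- `x` is upper unitriangular. -/
def upperUni {n : ℕ} (x : Mat n) : Prop :=
  (∀ i, x i i = 1) ∧ ∀ i j : Fin n, j < i → x i j = 0

/-- `x` is lower unitriangular. -/
def lowerUni {n : ℕ} (x : Mat n) : Prop :=
  (∀ i, x i i = 1) ∧ ∀ i j : Fin n, i < j → x i j = 0

/-- `x` is invertible upper triangular (`x ∈ B`). -/
def upperTriInv {n : ℕ} (x : Mat n) : Prop :=
  IsUnit x.det ∧ ∀ i j : Fin n, j < i → x i j = 0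

/-- `x` is invertible lower triangular (`x ∈ B_-`). -/
def lowerTriInv {n : ℕ} (x : Mat n) : Prop :=
  IsUnit x.det ∧ ∀ i j : Fin n, i < j → x i j = 0

/-- `x` is invertible diagonal (`x ∈ H`). -/
def diagInv {n : ℕ} (x : Mat n) : Prop :=
  IsUnit x.det ∧ ∀ i j : Fin n, i ≠ j → x i j = 0

/-- `x` admits a Gaussian decomposition (`x ∈ G_0`). -/
def hasGauss {n : ℕ} (x : Mat n) : Prop :=
  ∃ a d b : Mat n, lowerUni a ∧ diagInv d ∧ upperUni b ∧ x = a * d * b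

/-- The factor `[x]_-` of the Gaussian decomposition (junk value `1` if none exists). -/
noncomputable def gaussMinus {n : ℕ} (x : Mat n) : Mat n :=
  if h : hasGauss x then h.choose else 1

/-- The factor `[x]_0` of the Gaussian decomposition (junk value `1` if none exists). -/
noncomputable def gaussDiag {n : ℕ} (x : Mat n) : Mat n :=
  if h : hasGauss x then h.choose_spec.choose else 1

/-- The factor `[x]_+` of the Gaussian decomposition (junk value `1` if none exists). -/
noncomputable def gaussPlus {n : ℕ} (x : Mat n) : Mat n :=
  if h : hasGauss x then h.choose_spec.choose_spec.choose else 1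

/-- The permutation matrix of `w`, with entry `1` in position `(w j, j)`. -/
def permMat {n : ℕ} (w : Equiv.Perm (Fin n)) : Mat n :=
  Matrix.of fun i j => if i = w j then (1 : ℝ) else 0

/-- The minor of `x` with row set `I` and column set `J` (taken in increasing order). -/
def minorOf {n : ℕ} (x : Mat n) (k : ℕ) (I J : Finset (Fin n))
    (hI : I.card = k) (hJ : J.card = k) : ℝ :=
  Matrix.det (Matrix.of fun a b : Fin k => x (I.orderEmbOfFin hI a) (J.orderEmbOfFin hJ b))

/-- `x` is totally nonnegative: all its minors are nonnegative. -/
def totNonneg {n : ℕ} (x : Mat n) : Prop :=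
  ∀ (k : ℕ) (I J : Finset (Fin n)) (hI : I.card = k) (hJ : J.card = k),
    0 ≤ minorOf x k I J hI hJ

/-- The Bruhat order on the symmetric group. -/
def bruhatLE {n : ℕ} (u v : Equiv.Perm (Fin n)) : Prop :=
  ∀ i j : Fin n,
    (Finset.univ.filter fun k : Fin n => k ≤ i ∧ j ≤ u k).card ≤
    (Finset.univ.filter fun k : Fin n => k ≤ i ∧ j ≤ v k).card

/-- The double coset `B_- w B_-`. -/
def doubleCosetBm {n : ℕ} (w : Equiv.Perm (Fin n)) : Set (Mat n) :=
  {x | ∃ b₁ b₂ : Mat n, lowerTriInv b₁ ∧ lowerTriInv b₂ ∧ x = b₁ * permMat w * b₂}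

/-- `N^w = B_- w B_- ∩ N`. -/
def Ncell {n : ℕ} (w : Equiv.Perm (Fin n)) : Set (Mat n) :=
  {x | upperUni x ∧ x ∈ doubleCosetBm w}

/-- `N_-(w) = w⁻¹ N w ∩ N_-`. -/
def Nminus {n : ℕ} (w : Equiv.Perm (Fin n)) : Set (Mat n) :=
  {x | lowerUni x ∧ ∃ y : Mat n, upperUni y ∧ x = permMat w⁻¹ * y * permMat w}

/-- `N(w) = w⁻¹ N w ∩ N`. -/
def Ngrp {n : ℕ} (w : Equiv.Perm (Fin n)) : Set (Mat n) :=
  {x | upperUni x ∧ ∃ y : Mat n, upperUni y ∧ x = permMat w⁻¹ * y * permMat w}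

/-- The totally positive cell `Y°_w = Y ∩ B_- w B_-`. -/
def Ycirc {n : ℕ} (w : Equiv.Perm (Fin n)) : Set (Mat n) :=
  {x | upperUni x ∧ totNonneg x ∧ x ∈ doubleCosetBm w}

/-- `Y_{≥ u} = ⋃_{v ≥ u} Y°_v`. -/
def Yge {n : ℕ} (u : Equiv.Perm (Fin n)) : Set (Mat n) :=
  {x | ∃ v, bruhatLE u v ∧ x ∈ Ycirc v}

/-- `A = u⁻¹ [x u⁻¹]_+ u`. -/
noncomputable def Amat {n : ℕ} (u : Equiv.Perm (Fin n)) (x : Mat n) : Mat n :=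
  permMat u⁻¹ * gaussPlus (x * permMat u⁻¹) * permMat u

/-- The projection `π_u(x) = [u [u⁻¹ [x u⁻¹]_+ u]_-]_+`. -/
noncomputable def piMap {n : ℕ} (u : Equiv.Perm (Fin n)) (x : Mat n) : Mat n :=
  gaussPlus (permMat u * gaussMinus (Amat u x))

/-- `str(M)`: the sum of the matrix entries immediately above the main diagonal. -/
def strAbove {n : ℕ} (M : Mat n) : ℝ :=
  ∑ p : Fin n × Fin n, if (p.1 : ℕ) + 1 = (p.2 : ℕ) then M p.1 p.2 else 0

/-- The number of inversions (the length) of a permutation. -/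
def invNum {n : ℕ} (w : Equiv.Perm (Fin n)) : ℕ :=
  (Finset.univ.filter fun p : Fin n × Fin n => p.1 < p.2 ∧ w p.2 < w p.1).card

/-- The projection `ρ_{x_u}` sending `x̃` to the unique element `[x̃ n_-]_+ ∈ x_u N(u)` with
`n_- ∈ N_-(u)` (junk value `1` if no such `n_-` exists). -/
noncomputable def rho {n : ℕ} (u : Equiv.Perm (Fin n)) (xu : Mat n) (x : Mat n) : Mat n :=
  if h : ∃ nm ∈ Nminus u, hasGauss (x * nm) ∧ ∃ m ∈ Ngrp u, gaussPlus (x * nm) = xu * m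
  then gaussPlus (x * h.choose) else 1

section

open Matrix

/-- `M` has unit diagonal and is block triangular for the ordering of the indices by `v`. -/
def UniFor {n : ℕ} (v : Fin n → ℤ) (M : Mat n) : Prop :=
  (∀ i, M i i = 1) ∧ M.BlockTriangular v

/-- The natural ordering of the indices. -/
def idx {n : ℕ} (i : Fin n) : ℤ := (i : ℤ)

/-- The reversed ordering of the indices. -/
def negIdx {n : ℕ} (i : Fin n) : ℤ := -(i : ℤ)

/-- The ordering of the indices through a permutation. -/
def permIdx {n : ℕ} (u : Equiv.Perm (Fin n)) (i : Fin n) : ℤ := ((u i : Fin n) : ℤ)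

lemma idx_injective {n : ℕ} : Function.Injective (idx : Fin n → ℤ) := by
  intro i j h; simp only [idx] at h; exact Fin.ext (by exact_mod_cast h)

lemma negIdx_injective {n : ℕ} : Function.Injective (negIdx : Fin n → ℤ) := by
  intro i j h; simp only [negIdx] at h; exact Fin.ext (by omega)

lemma permIdx_injective {n : ℕ} (u : Equiv.Perm (Fin n)) : Function.Injective (permIdx u) := by
  intro i j h; simp only [permIdx] at h
  exact u.injective (Fin.ext (by exact_mod_cast h))

lemma upperUni_iff {n : ℕ} {M : Mat n} : upperUni M ↔ UniFor idx M := by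
  constructor
  · rintro ⟨h1, h2⟩
    exact ⟨h1, fun i j h => h2 i j (by simp only [idx] at h; exact Fin.lt_def.2 (by omega))⟩
  · rintro ⟨h1, h2⟩
    exact ⟨h1, fun i j h => h2 (by simp only [idx]; have := Fin.lt_def.1 h; omega)⟩

lemma lowerBlock_iff {n : ℕ} {M : Mat n} :
    (∀ i j : Fin n, i < j → M i j = 0) ↔ M.BlockTriangular negIdx := by
  constructor
  · intro h2 i j h
    exact h2 i j (by simp only [negIdx] at h; exact Fin.lt_def.2 (by omega))
  · intro h2 i j h
    exact h2 (by simp only [negIdx]; have := Fin.lt_def.1 h; omega)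

lemma lowerUni_iff {n : ℕ} {M : Mat n} : lowerUni M ↔ UniFor negIdx M :=
  and_congr Iff.rfl lowerBlock_iff

lemma lowerTriInv_iff {n : ℕ} {M : Mat n} :
    lowerTriInv M ↔ IsUnit M.det ∧ M.BlockTriangular negIdx :=
  and_congr Iff.rfl lowerBlock_iff

lemma mul_diag_of_blockTriangular {n : ℕ} {v : Fin n → ℤ} (hv : Function.Injective v)
    {M N : Mat n} (hM : M.BlockTriangular v) (hN : N.BlockTriangular v) (i : Fin n) :
    (M * N) i i = M i i * N i i := by
  rw [Matrix.mul_apply]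
  refine Finset.sum_eq_single i (fun j _ hj => ?_) (by simp)
  rcases lt_trichotomy (v j) (v i) with h | h | h
  · rw [hM h, zero_mul]
  · exact absurd (hv h) hj
  · rw [hN h, mul_zero]

lemma det_of_blockTriangular {k : ℕ} {v : Fin k → ℤ} (hv : Function.Injective v)
    {M : Mat k} (hM : M.BlockTriangular v) : M.det = ∏ i, M i i := by
  rw [← Matrix.det_submatrix_equiv_self (Tuple.sort v) M, Matrix.det_of_isUpperTriangular]
  · simpa using Equiv.prod_comp (Tuple.sort v) (fun i => M i i)
  · intro i j h
    have h1 : Monotone (v ∘ Tuple.sort v) := Tuple.monotone_sort v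
    have h2 : Function.Injective (v ∘ Tuple.sort v) := hv.comp (Tuple.sort v).injective
    exact hM ((h1.strictMono_of_injective h2) h)

lemma UniFor.mul {n : ℕ} {v : Fin n → ℤ} (hv : Function.Injective v) {M N : Mat n}
    (hM : UniFor v M) (hN : UniFor v N) : UniFor v (M * N) :=
  ⟨fun i => by rw [mul_diag_of_blockTriangular hv hM.2 hN.2, hM.1, hN.1, one_mul],
    hM.2.mul hN.2⟩

lemma UniFor.det {n : ℕ} {v : Fin n → ℤ} (hv : Function.Injective v) {M : Mat n}
    (hM : UniFor v M) : M.det = 1 := by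
  rw [det_of_blockTriangular hv hM.2]; simp [hM.1]

lemma uniFor_one {n : ℕ} (v : Fin n → ℤ) : UniFor v (1 : Mat n) :=
  ⟨fun i => by simp, Matrix.blockTriangular_one⟩

lemma blockTriangular_inv {n : ℕ} {v : Fin n → ℤ} {M : Mat n} (hd : IsUnit M.det)
    (hM : M.BlockTriangular v) : M⁻¹.BlockTriangular v := by
  let _ : Invertible M := Matrix.invertibleOfIsUnitDet M hd
  exact Matrix.blockTriangular_inv_of_blockTriangular hM

lemma UniFor.isUnit {n : ℕ} {v : Fin n → ℤ} (hv : Function.Injective v) {M : Mat n}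
    (hM : UniFor v M) : IsUnit M.det := by rw [hM.det hv]; exact isUnit_one

lemma UniFor.inv {n : ℕ} {v : Fin n → ℤ} (hv : Function.Injective v) {M : Mat n}
    (hM : UniFor v M) : UniFor v M⁻¹ := by
  have h := blockTriangular_inv (hM.isUnit hv) hM.2
  refine ⟨fun i => ?_, h⟩
  have h1 := mul_diag_of_blockTriangular hv hM.2 h i
  rw [Matrix.mul_nonsing_inv _ (hM.isUnit hv), hM.1 i] at h1
  simpa using h1.symm

lemma upperUni.isUnit {n : ℕ} {M : Mat n} (hM : upperUni M) : IsUnit M.det :=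
  (upperUni_iff.1 hM).isUnit idx_injective

lemma lowerUni.isUnit {n : ℕ} {M : Mat n} (hM : lowerUni M) : IsUnit M.det :=
  (lowerUni_iff.1 hM).isUnit negIdx_injective

lemma upperUni.mul {n : ℕ} {M N : Mat n} (hM : upperUni M) (hN : upperUni N) : upperUni (M * N) :=
  upperUni_iff.2 ((upperUni_iff.1 hM).mul idx_injective (upperUni_iff.1 hN))

lemma upperUni.inv {n : ℕ} {M : Mat n} (hM : upperUni M) : upperUni M⁻¹ :=
  upperUni_iff.2 ((upperUni_iff.1 hM).inv idx_injective)

lemma lowerUni.mul {n : ℕ} {M N : Mat n} (hM : lowerUni M) (hN : lowerUni N) : lowerUni (M * N) :=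
  lowerUni_iff.2 ((lowerUni_iff.1 hM).mul negIdx_injective (lowerUni_iff.1 hN))

lemma lowerUni.inv {n : ℕ} {M : Mat n} (hM : lowerUni M) : lowerUni M⁻¹ :=
  lowerUni_iff.2 ((lowerUni_iff.1 hM).inv negIdx_injective)

lemma lowerTriInv.mul {n : ℕ} {M N : Mat n} (hM : lowerTriInv M) (hN : lowerTriInv N) :
    lowerTriInv (M * N) := by
  rw [lowerTriInv_iff] at *
  exact ⟨by rw [Matrix.det_mul]; exact hM.1.mul hN.1, hM.2.mul hN.2⟩

lemma lowerTriInv.inv {n : ℕ} {M : Mat n} (hM : lowerTriInv M) : lowerTriInv M⁻¹ := by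
  rw [lowerTriInv_iff] at *
  exact ⟨Matrix.isUnit_nonsing_inv_det _ hM.1, blockTriangular_inv hM.1 hM.2⟩

lemma lowerUni.triInv {n : ℕ} {M : Mat n} (hM : lowerUni M) : lowerTriInv M := ⟨hM.isUnit, hM.2⟩

lemma diagInv.triInv {n : ℕ} {M : Mat n} (hM : diagInv M) : lowerTriInv M :=
  ⟨hM.1, fun i j h => hM.2 i j h.ne⟩

lemma lowerUni_one {n : ℕ} : lowerUni (1 : Mat n) := lowerUni_iff.2 (uniFor_one _)

lemma lowerTriInv_one {n : ℕ} : lowerTriInv (1 : Mat n) := lowerUni_one.triInv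

lemma eq_one_of_upperUni_of_lower {n : ℕ} {M : Mat n} (h1 : upperUni M)
    (h2 : ∀ i j : Fin n, i < j → M i j = 0) : M = 1 := by
  ext i j
  rcases lt_trichotomy i j with h | h | h
  · rw [h2 i j h, Matrix.one_apply_ne h.ne]
  · subst h; rw [h1.1, Matrix.one_apply_eq]
  · rw [h1.2 i j h, Matrix.one_apply_ne h.ne']

/-- Factorizations in `B_- N` are unique. -/
lemma lowerTri_mul_unique {n : ℕ} {l l' b b' : Mat n} (hl : lowerTriInv l) (hl' : lowerTriInv l')
    (hb : upperUni b) (hb' : upperUni b') (h : l * b = l' * b') : l = l' ∧ b = b' := by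
  have h1 : l'⁻¹ * l = b' * b⁻¹ := by
    have : l = l' * b' * b⁻¹ := by
      rw [← h, Matrix.mul_assoc, Matrix.mul_nonsing_inv _ hb.isUnit, Matrix.mul_one]
    rw [this, Matrix.mul_assoc, ← Matrix.mul_assoc l'⁻¹, Matrix.nonsing_inv_mul _ hl'.1,
      Matrix.one_mul]
  have h2 : b' * b⁻¹ = 1 :=
    eq_one_of_upperUni_of_lower (hb'.mul hb.inv) (h1 ▸ (hl'.inv.mul hl).2)
  have h3 : b = b' := by
    calc b = (b' * b⁻¹) * b := by rw [h2, Matrix.one_mul]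
      _ = b' := by rw [Matrix.mul_assoc, Matrix.nonsing_inv_mul _ hb.isUnit, Matrix.mul_one]
  have h4 : l = l' := by
    calc l = l' * (l'⁻¹ * l) := by
            rw [← Matrix.mul_assoc, Matrix.mul_nonsing_inv _ hl'.1, Matrix.one_mul]
      _ = l' := by rw [h1, h2, Matrix.mul_one]
  exact ⟨h4, h3⟩

/-- An invertible lower triangular matrix is a lower unitriangular one times a diagonal one. -/
lemma lowerTriInv.factor {n : ℕ} {l : Mat n} (hl : lowerTriInv l) :
    ∃ a d : Mat n, lowerUni a ∧ diagInv d ∧ l = a * d := by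
  have hdet := det_of_blockTriangular negIdx_injective (lowerTriInv_iff.1 hl).2
  have hne : ∀ i, l i i ≠ 0 := by
    have h := hl.1.ne_zero
    rw [hdet, Finset.prod_ne_zero_iff] at h
    exact fun i => h i (Finset.mem_univ i)
  refine ⟨l * Matrix.diagonal (fun i => (l i i)⁻¹), Matrix.diagonal (fun i => l i i),
    ⟨fun i => ?_, fun i j h => ?_⟩, ⟨?_, fun i j h => Matrix.diagonal_apply_ne _ h⟩, ?_⟩
  · rw [Matrix.mul_diagonal, mul_inv_cancel₀ (hne i)]
  · rw [Matrix.mul_diagonal, hl.2 i j h, zero_mul]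
  · rw [Matrix.det_diagonal, ← hdet]; exact hl.1
  · rw [Matrix.mul_assoc, Matrix.diagonal_mul_diagonal]
    have : (fun i => (l i i)⁻¹ * l i i) = fun _ => (1 : ℝ) := by
      ext i; exact inv_mul_cancel₀ (hne i)
    rw [this, Matrix.diagonal_one, Matrix.mul_one]

lemma hasGauss_mul {n : ℕ} {l b : Mat n} (hl : lowerTriInv l) (hb : upperUni b) :
    hasGauss (l * b) := by
  obtain ⟨a, d, ha, hd, rfl⟩ := hl.factor
  exact ⟨a, d, b, ha, hd, hb, rfl⟩

lemma gaussPlus_spec {n : ℕ} {x : Mat n} (h : hasGauss x) :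
    upperUni (gaussPlus x) ∧ ∃ l, lowerTriInv l ∧ x = l * gaussPlus x := by
  unfold gaussPlus
  rw [dif_pos h]
  have := h.choose_spec.choose_spec.choose_spec
  exact ⟨this.2.2.1, _, this.1.triInv.mul this.2.1.triInv, this.2.2.2⟩

lemma gaussPlus_mul {n : ℕ} {l b : Mat n} (hl : lowerTriInv l) (hb : upperUni b) :
    gaussPlus (l * b) = b := by
  obtain ⟨h1, l', hl', h2⟩ := gaussPlus_spec (hasGauss_mul hl hb)
  exact (lowerTri_mul_unique hl hl' hb h1 h2).2.symm

lemma gaussPlus_of_upperUni {n : ℕ} {b : Mat n} (hb : upperUni b) : gaussPlus b = b := by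
  simpa using gaussPlus_mul lowerTriInv_one hb

lemma gaussPlus_lower_mul {n : ℕ} {l g : Mat n} (hl : lowerTriInv l) (hg : hasGauss g) :
    gaussPlus (l * g) = gaussPlus g := by
  obtain ⟨h1, l', hl', h2⟩ := gaussPlus_spec hg
  conv_lhs => rw [h2, ← Matrix.mul_assoc]
  exact gaussPlus_mul (hl.mul hl') h1

lemma hasGauss_lower_mul {n : ℕ} {l g : Mat n} (hl : lowerTriInv l) (hg : hasGauss g) :
    hasGauss (l * g) := by
  obtain ⟨h1, l', hl', h2⟩ := gaussPlus_spec hg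
  rw [h2, ← Matrix.mul_assoc]
  exact hasGauss_mul (hl.mul hl') h1

lemma gaussMinus_mul {n : ℕ} {a b : Mat n} (ha : lowerUni a) (hb : upperUni b) :
    gaussMinus (a * b) = a := by
  have hg := hasGauss_mul ha.triInv hb
  unfold gaussMinus
  rw [dif_pos hg]
  obtain ⟨h1, h2, h3, h4⟩ := hg.choose_spec.choose_spec.choose_spec
  set a' := hg.choose
  set d' := hg.choose_spec.choose
  set b' := hg.choose_spec.choose_spec.choose
  have h5 := (lowerTri_mul_unique ha.triInv (h1.triInv.mul h2.triInv) hb h3 h4).1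
  have hd : d' = 1 := by
    ext i j
    rcases eq_or_ne i j with rfl | h
    · have := mul_diag_of_blockTriangular negIdx_injective (lowerUni_iff.1 h1).2
        (lowerTriInv_iff.1 h2.triInv).2 i
      rw [← h5, ha.1, h1.1, one_mul] at this
      rw [← this, Matrix.one_apply_eq]
    · rw [h2.2 i j h, Matrix.one_apply_ne h]
  rw [h5, hd, Matrix.mul_one]

/-- The minor on the first `k` rows with columns listed by `J`. -/
noncomputable def flag {n : ℕ} (x : Mat n) {k : ℕ} (hk : k ≤ n) (J : Fin k → Fin n) : ℝ :=
  (x.submatrix (Fin.castLE hk) J).det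

lemma submatrix_lower_mul {n k : ℕ} (hk : k ≤ n) {l : Mat n} (hl : l.BlockTriangular negIdx)
    (x : Mat n) (J : Fin k → Fin n) :
    (l * x).submatrix (Fin.castLE hk) J =
      l.submatrix (Fin.castLE hk) (Fin.castLE hk) * x.submatrix (Fin.castLE hk) J := by
  ext i j
  simp only [Matrix.submatrix_apply, Matrix.mul_apply]
  refine (Fintype.sum_of_injective (Fin.castLE hk) (Fin.castLE_injective hk) _ _ ?_ ?_).symm
  · intro p hp
    rw [hl, zero_mul]
    simp only [negIdx]
    have : k ≤ (p : ℕ) := by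
      by_contra h
      exact hp ⟨⟨p, by omega⟩, rfl⟩
    have := i.2
    simp only [Fin.val_castLE]
    omega
  · intro i; rfl

lemma submatrix_mul_upper {n k : ℕ} (hk : k ≤ n) {b : Mat n} (hb : b.BlockTriangular idx)
    (x : Mat n) (I : Fin k → Fin n) :
    (x * b).submatrix I (Fin.castLE hk) =
      x.submatrix I (Fin.castLE hk) * b.submatrix (Fin.castLE hk) (Fin.castLE hk) := by
  ext i j
  simp only [Matrix.submatrix_apply, Matrix.mul_apply]
  refine (Fintype.sum_of_injective (Fin.castLE hk) (Fin.castLE_injective hk) _ _ ?_ ?_).symm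
  · intro p hp
    rw [hb, mul_zero]
    simp only [idx]
    have : k ≤ (p : ℕ) := by
      by_contra h
      exact hp ⟨⟨p, by omega⟩, rfl⟩
    have := j.2
    simp only [Fin.val_castLE]
    omega
  · intro i; rfl

lemma flag_lower_mul {n k : ℕ} (hk : k ≤ n) {l : Mat n} (hl : lowerTriInv l) (x : Mat n)
    (J : Fin k → Fin n) : flag (l * x) hk J = flag l hk (Fin.castLE hk) * flag x hk J := by
  unfold flag
  rw [submatrix_lower_mul hk (lowerTriInv_iff.1 hl).2, Matrix.det_mul]

lemma det_submatrix_blockTriangular {n k : ℕ} {v : Fin n → ℤ} (hv : Function.Injective v)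
    {g : Mat n} (hg : g.BlockTriangular v) {f : Fin k → Fin n} (hf : Function.Injective f) :
    (g.submatrix f f).det = ∏ i, g (f i) (f i) :=
  det_of_blockTriangular (v := v ∘ f) (hv.comp hf) (hg.submatrix)

lemma diag_ne_zero {n : ℕ} {v : Fin n → ℤ} (hv : Function.Injective v)
    {g : Mat n} (hg : g.BlockTriangular v) (hd : g.det ≠ 0) (i : Fin n) : g i i ≠ 0 := by
  rw [det_of_blockTriangular hv hg, Finset.prod_ne_zero_iff] at hd
  exact hd i (Finset.mem_univ i)

lemma leading_ne_zero {n k : ℕ} (hk : k ≤ n) {v : Fin n → ℤ} (hv : Function.Injective v)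
    {g : Mat n} (hg : g.BlockTriangular v) (hd : g.det ≠ 0) :
    flag g hk (Fin.castLE hk) ≠ 0 := by
  unfold flag
  rw [det_submatrix_blockTriangular hv hg (Fin.castLE_injective hk), Finset.prod_ne_zero_iff]
  exact fun i _ => diag_ne_zero hv hg hd _

lemma lowerTriInv.leading_ne_zero {n k : ℕ} (hk : k ≤ n) {l : Mat n} (hl : lowerTriInv l) :
    flag l hk (Fin.castLE hk) ≠ 0 :=
  BruhatTNN.leading_ne_zero hk negIdx_injective (lowerTriInv_iff.1 hl).2 hl.1.ne_zero

lemma upperUni.leading {n k : ℕ} (hk : k ≤ n) {b : Mat n} (hb : upperUni b) :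
    flag b hk (Fin.castLE hk) = 1 := by
  unfold flag
  rw [det_submatrix_blockTriangular idx_injective (upperUni_iff.1 hb).2 (Fin.castLE_injective hk)]
  simp [hb.1]

lemma upperTri_factor {n : ℕ} {t : Mat n} (ht : t.BlockTriangular idx) (hd : t.det ≠ 0) :
    ∃ d b : Mat n, diagInv d ∧ upperUni b ∧ t = d * b := by
  have hne := diag_ne_zero idx_injective ht hd
  refine ⟨Matrix.diagonal (fun i => t i i), Matrix.diagonal (fun i => (t i i)⁻¹) * t,
    ⟨?_, fun i j h => Matrix.diagonal_apply_ne _ h⟩, upperUni_iff.2 ⟨fun i => ?_, ?_⟩, ?_⟩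
  · rw [Matrix.det_diagonal, ← det_of_blockTriangular idx_injective ht]; exact hd.isUnit
  · rw [Matrix.diagonal_mul, inv_mul_cancel₀ (hne i)]
  · exact (Matrix.blockTriangular_diagonal _).mul ht
  · rw [← Matrix.mul_assoc, Matrix.diagonal_mul_diagonal]
    have : (fun i => t i i * (t i i)⁻¹) = fun _ => (1 : ℝ) := by
      ext i; exact mul_inv_cancel₀ (hne i)
    rw [this, Matrix.diagonal_one, Matrix.one_mul]

lemma hasGauss_of_leading {n : ℕ} {x : Mat n}
    (h : ∀ (k : ℕ) (hk : k ≤ n), flag x hk (Fin.castLE hk) ≠ 0) : hasGauss x := by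
  have key : ∀ k : Fin n, ∃ c : Fin (k : ℕ) → ℝ, ∀ j : Fin (k : ℕ),
      ∑ i, c i * x (Fin.castLE k.2.le i) (Fin.castLE k.2.le j) =
        - x k (Fin.castLE k.2.le j) := by
    intro k
    set X := x.submatrix (Fin.castLE k.2.le) (Fin.castLE k.2.le) with hX
    have hu : IsUnit X.det := (h k k.2.le).isUnit
    refine ⟨Matrix.vecMul (fun j => - x k (Fin.castLE k.2.le j)) X⁻¹, fun j => ?_⟩
    have h1 : Matrix.vecMul (Matrix.vecMul (fun j => - x k (Fin.castLE k.2.le j)) X⁻¹) X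
        = fun j => - x k (Fin.castLE k.2.le j) := by
      rw [Matrix.vecMul_vecMul, Matrix.nonsing_inv_mul _ hu, Matrix.vecMul_one]
    exact congrFun h1 j
  choose c hc using key
  set a : Mat n := Matrix.of fun k i =>
    (if k = i then 1 else 0) + (if hi : i < k then c k ⟨i, hi⟩ else 0) with ha
  have hal : lowerUni a := by
    refine ⟨fun i => by simp [ha], fun i j hij => ?_⟩
    simp [ha, hij.ne, hij.le]
  have hT : (a * x).BlockTriangular idx := by
    intro k j hjk
    have hjk' : (j : ℕ) < k := by simp only [idx] at hjk; omega
    rw [Matrix.mul_apply]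
    simp only [ha, Matrix.of_apply, add_mul, Finset.sum_add_distrib, ite_mul, one_mul, zero_mul,
      Finset.sum_ite_eq, Finset.mem_univ, if_true]
    have h1 := hc k ⟨j, hjk'⟩
    have h2 : ∑ i, c k i * x (Fin.castLE k.2.le i) j =
        ∑ p : Fin n, (if hi : p < k then c k ⟨p, hi⟩ else 0) * x p j := by
      refine Fintype.sum_of_injective (Fin.castLE k.2.le) (Fin.castLE_injective _) _ _ ?_ ?_
      · intro p hp
        rw [dif_neg, zero_mul]
        intro hpk
        exact hp ⟨⟨p, hpk⟩, rfl⟩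
      · intro i
        have : Fin.castLE k.2.le i < k := i.2
        rw [dif_pos this]
        rfl
    rw [← h2]
    have h3 : Fin.castLE k.2.le ⟨j, hjk'⟩ = j := rfl
    rw [h3] at h1
    rw [h1, add_neg_cancel]
  have hx : x.det ≠ 0 := by
    have := h n le_rfl
    simpa [flag] using this
  obtain ⟨d, b, hd, hb, hdb⟩ := upperTri_factor hT (by
    rw [Matrix.det_mul, (lowerUni_iff.1 hal).det negIdx_injective, one_mul]; exact hx)
  refine ⟨a⁻¹, d, b, hal.inv, hd, hb, ?_⟩
  rw [Matrix.mul_assoc, ← hdb, ← Matrix.mul_assoc, Matrix.nonsing_inv_mul _ hal.isUnit,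
    Matrix.one_mul]

/-- The columns `0, …, k - 1, j`. -/
def colsWith {n k : ℕ} (hk : k + 1 ≤ n) (j : Fin n) : Fin (k + 1) → Fin n :=
  Fin.snoc (α := fun _ => Fin n) (fun i : Fin k => Fin.castLE (by omega) i) j

lemma flag_colsWith {n k : ℕ} (hk : k + 1 ≤ n) {b : Mat n} (hb : upperUni b) (j : Fin n) :
    flag b hk (colsWith hk j) = b ⟨k, hk⟩ j := by
  unfold flag
  rw [Matrix.det_of_isUpperTriangular, Fin.prod_univ_castSucc]
  · have h1 : ∀ i : Fin k,
        b.submatrix (Fin.castLE hk) (colsWith hk j) i.castSucc i.castSucc = 1 := by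
      intro i
      simp only [Matrix.submatrix_apply, colsWith, Fin.snoc_castSucc]
      exact hb.1 _
    rw [Finset.prod_eq_one fun i _ => h1 i, one_mul, Matrix.submatrix_apply, colsWith,
      Fin.snoc_last]
    rfl
  · intro i c hci
    simp only [id] at hci
    simp only [Matrix.submatrix_apply]
    induction c using Fin.lastCases with
    | last => exact absurd (Fin.le_last i) (not_le.2 hci)
    | cast c =>
      simp only [colsWith, Fin.snoc_castSucc]
      exact hb.2 _ _ hci

lemma gaussPlus_apply {n : ℕ} {x : Mat n} (hx : hasGauss x) (k j : Fin n) :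
    gaussPlus x k j = flag x k.2 (colsWith k.2 j) / flag x k.2 (Fin.castLE k.2) := by
  obtain ⟨hb, l, hl, hxl⟩ := gaussPlus_spec hx
  have h1 : ∀ J, flag x k.2 J = flag l k.2 (Fin.castLE k.2) * flag (gaussPlus x) k.2 J := by
    intro J
    conv_lhs => rw [hxl]
    exact flag_lower_mul k.2 hl _ J
  rw [h1, h1, flag_colsWith k.2 hb, hb.leading]
  have := hl.leading_ne_zero k.2
  field_simp

lemma hasGauss.leading_ne_zero {n k : ℕ} (hk : k ≤ n) {x : Mat n} (hx : hasGauss x) :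
    flag x hk (Fin.castLE hk) ≠ 0 := by
  obtain ⟨hb, l, hl, hxl⟩ := gaussPlus_spec hx
  rw [hxl, flag_lower_mul hk hl, hb.leading, mul_one]
  exact hl.leading_ne_zero hk

lemma exists_perm_of_det_ne_zero {k : ℕ} {M : Mat k} (h : M.det ≠ 0) :
    ∃ σ : Equiv.Perm (Fin k), ∀ i, M (σ i) i ≠ 0 := by
  rw [Matrix.det_apply] at h
  obtain ⟨σ, -, hσ⟩ := Finset.exists_ne_zero_of_sum_ne_zero h
  refine ⟨σ, fun i hi => hσ ?_⟩
  have : ∏ i, M (σ i) i = 0 := Finset.prod_eq_zero (Finset.mem_univ i) hi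
  rw [this, smul_zero]

lemma hasGauss_of_blockTriangular {n : ℕ} {v : Fin n → ℤ} (hv : Function.Injective v) {g : Mat n}
    (hg : g.BlockTriangular v) (hd : g.det ≠ 0) : hasGauss g :=
  hasGauss_of_leading fun _ hk => leading_ne_zero hk hv hg hd

lemma gaussPlus_blockTriangular {n : ℕ} {v : Fin n → ℤ} (hv : Function.Injective v) {g : Mat n}
    (hg : g.BlockTriangular v) (hd : g.det ≠ 0) : (gaussPlus g).BlockTriangular v := by
  intro k j hjk
  rw [gaussPlus_apply (hasGauss_of_blockTriangular hv hg hd)]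
  by_contra hne
  have h1 : flag g k.2 (colsWith k.2 j) ≠ 0 := fun h => hne (by rw [h, zero_div])
  obtain ⟨σ, hσ⟩ := exists_perm_of_det_ne_zero h1
  have h2 : ∀ i, v (Fin.castLE k.2 (σ i)) ≤ v (colsWith k.2 j i) := fun i => by
    by_contra h
    exact hσ i (hg (not_le.1 h))
  have h3 := Finset.sum_le_sum (s := Finset.univ) fun i _ => h2 i
  rw [Equiv.sum_comp σ (fun i => v (Fin.castLE k.2 i)), Fin.sum_univ_castSucc,
    Fin.sum_univ_castSucc] at h3
  simp only [colsWith, Fin.snoc_castSucc, Fin.snoc_last] at h3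
  have h4 : Fin.castLE k.2 (Fin.last (k : ℕ)) = k := rfl
  rw [h4] at h3
  have h5 : ∑ i : Fin (k : ℕ), v (Fin.castLE k.2 i.castSucc) =
    ∑ i : Fin (k : ℕ), v (Fin.castLE (by omega) i) := rfl
  rw [h5] at h3
  linarith

lemma UniFor.gauss {n : ℕ} {v : Fin n → ℤ} (hv : Function.Injective v) {g : Mat n}
    (hg : UniFor v g) : hasGauss g ∧ UniFor v (gaussPlus g) ∧
      ∃ a, lowerUni a ∧ UniFor v a ∧ g = a * gaussPlus g := by
  have hd : g.det ≠ 0 := (hg.isUnit hv).ne_zero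
  have hG := hasGauss_of_blockTriangular hv hg.2 hd
  obtain ⟨hb, l, hl, hxl⟩ := gaussPlus_spec hG
  have hbv : UniFor v (gaussPlus g) := ⟨hb.1, gaussPlus_blockTriangular hv hg.2 hd⟩
  have hlv : UniFor v l := by
    have : l = g * (gaussPlus g)⁻¹ := by
      conv_rhs => rw [hxl]
      rw [gaussPlus_mul hl hb, Matrix.mul_assoc, Matrix.mul_nonsing_inv _ hb.isUnit, Matrix.mul_one]
    rw [this]
    exact hg.mul hv (hbv.inv hv)
  exact ⟨hG, hbv, l, ⟨hlv.1, hl.2⟩, hlv, hxl⟩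

lemma continuous_gaussPlus {n : ℕ} {S : Type*} [TopologicalSpace S] {X : S → Mat n}
    (hX : Continuous X) (hg : ∀ s, hasGauss (X s)) : Continuous fun s => gaussPlus (X s) := by
  refine continuous_matrix fun k j => ?_
  simp only [fun s => gaussPlus_apply (hg s) k j]
  unfold flag
  exact ((hX.matrix_submatrix _ _).matrix_det).div ((hX.matrix_submatrix _ _).matrix_det)
    fun s => (hg s).leading_ne_zero k.2

/-- Total nonnegativity, phrased with strictly increasing tuples of rows and columns. -/
def tnn {n : ℕ} (x : Mat n) : Prop :=
  ∀ (k : ℕ) (f g : Fin k → Fin n), StrictMono f → StrictMono g → 0 ≤ (x.submatrix f g).det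

lemma totNonneg_iff {n : ℕ} {x : Mat n} : totNonneg x ↔ tnn x := by
  constructor
  · intro h k f g hf hg
    have hI : (Finset.univ.image f).card = k := by
      rw [Finset.card_image_of_injective _ hf.injective, Finset.card_univ, Fintype.card_fin]
    have hJ : (Finset.univ.image g).card = k := by
      rw [Finset.card_image_of_injective _ hg.injective, Finset.card_univ, Fintype.card_fin]
    have h1 := Finset.orderEmbOfFin_unique hI (f := f) (by simp) hf
    have h2 := Finset.orderEmbOfFin_unique hJ (f := g) (by simp) hg
    have h3 := h k _ _ hI hJ
    unfold minorOf at h3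
    rw [← h1, ← h2] at h3
    exact h3
  · intro h k I J hI hJ
    exact h k _ _ (I.orderEmbOfFin hI).strictMono (J.orderEmbOfFin hJ).strictMono

lemma strictMono_update_succ {n k : ℕ} {f : Fin k → Fin n} (hf : StrictMono f) (a : Fin k)
    {j : Fin n} (haj : (f a : ℕ) + 1 = j) (hj : ∀ b, f b ≠ j) :
    StrictMono (Function.update f a j) := by
  intro p q hpq
  have h1 := hf hpq
  simp only [Function.update_apply]
  rw [Fin.lt_def] at h1 ⊢
  split_ifs with hp hq hq
  · subst hp; subst hq; exact absurd hpq (lt_irrefl _)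
  · subst hp
    have : (f q : ℕ) ≠ j := fun h => hj q (Fin.ext h)
    omega
  · subst hq; omega
  · exact h1

lemma tnn.rowOp {n : ℕ} {x : Mat n} (h : tnn x) {i j : Fin n} (hij : (i : ℕ) + 1 = j) {c : ℝ}
    (hc : 0 ≤ c) : tnn (x.updateRow i (x i + c • x j)) := by
  intro k f g hf hg
  by_cases hi : ∃ a, f a = i
  · obtain ⟨a, rfl⟩ := hi
    have h1 : (x.updateRow (f a) (x (f a) + c • x j)).submatrix f g =
        (x.submatrix f g).updateRow a ((x.submatrix f g) a + c • fun b => x j (g b)) := by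
      ext p q
      by_cases hp : p = a
      · subst hp; simp
      · have : f p ≠ f a := fun h => hp (hf.injective h)
        simp [this, hp]
    rw [h1, Matrix.det_updateRow_add, Matrix.updateRow_eq_self, Matrix.det_updateRow_smul]
    refine add_nonneg (h k f g hf hg) (mul_nonneg hc ?_)
    have h2 : (x.submatrix f g).updateRow a (fun b => x j (g b)) =
        x.submatrix (Function.update f a j) g := by
      ext p q
      by_cases hp : p = a
      · subst hp; simp
      · simp [hp]
    rw [h2]
    by_cases hb : ∃ b, f b = j
    · obtain ⟨b, hb⟩ := hb
      have hab : a ≠ b := by rintro rfl; rw [hb] at hij; omega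
      rw [Matrix.det_zero_of_row_eq hab]
      ext q
      simp [hab.symm, hb]
    · exact h k _ _ (strictMono_update_succ hf a hij fun b hb' => hb ⟨b, hb'⟩) hg
  · have h1 : (x.updateRow i (x i + c • x j)).submatrix f g = x.submatrix f g := by
      ext p q
      have : f p ≠ i := fun h => hi ⟨p, h⟩
      simp [this]
    rw [h1]
    exact h k f g hf hg

/-- All minors on initial sets of rows are nonnegative. -/
def flagNonneg {n : ℕ} (x : Mat n) : Prop :=
  ∀ (k : ℕ) (hk : k ≤ n) (J : Fin k → Fin n), StrictMono J → 0 ≤ flag x hk J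

lemma tnn.flagNonneg {n : ℕ} {x : Mat n} (h : tnn x) : flagNonneg x :=
  fun k hk J hJ => h k _ J (Fin.strictMono_castLE hk) hJ

lemma strictMono_snoc {n k : ℕ} {f : Fin k → Fin n} (hf : StrictMono f) {v : Fin n}
    (hv : ∀ i, f i < v) : StrictMono (Fin.snoc (α := fun _ => Fin n) f v) := by
  rw [← Fin.insertNth_last', Fin.strictMono_insertNth_iff]
  exact ⟨hf, fun i _ => hv i, fun i hi => absurd hi (not_le.2 (Fin.castSucc_lt_last i))⟩

lemma strictMono_colsWith {n k : ℕ} (hk : k + 1 ≤ n) {j : Fin n} (hj : k ≤ (j : ℕ)) :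
    StrictMono (colsWith hk j) :=
  strictMono_snoc (Fin.strictMono_castLE _) fun i => by
    rw [Fin.lt_def]
    exact lt_of_lt_of_le i.2 hj

lemma det_last_row {k : ℕ} (M : Mat (k + 2))
    (h : ∀ j : Fin k, M (Fin.last _) j.castSucc.castSucc = 0) :
    M.det = M (Fin.last _) (Fin.last _) * (M.submatrix Fin.castSucc Fin.castSucc).det -
      M (Fin.last _) (Fin.last _).castSucc * (M.submatrix Fin.castSucc
        (Fin.snoc (α := fun _ => Fin (k + 2)) (fun j : Fin k => j.castSucc.castSucc)
          (Fin.last _))).det := by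
  rw [Matrix.det_succ_row M (Fin.last _), Fin.sum_univ_castSucc, Fin.sum_univ_castSucc,
    Finset.sum_eq_zero, Fin.succAbove_last]
  · have h1 : (Fin.last k).castSucc.succAbove =
        Fin.snoc (α := fun _ => Fin (k + 2)) (fun j : Fin k => j.castSucc.castSucc)
          (Fin.last _) := by
      ext j
      induction j using Fin.lastCases with
      | last => rw [Fin.snoc_last]; simp
      | cast j =>
        rw [Fin.snoc_castSucc, Fin.succAbove_of_castSucc_lt]
        exact Fin.castSucc_lt_castSucc_iff.2 (Fin.castSucc_lt_last j)
    rw [h1]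
    have h2 : ((-1 : ℝ)) ^ ((Fin.last (k + 1) : ℕ) + ((Fin.last k).castSucc : ℕ)) = -1 := by
      simp only [Fin.val_last, Fin.val_castSucc]
      exact Odd.neg_one_pow ⟨k, by omega⟩
    have h3 : ((-1 : ℝ)) ^ ((Fin.last (k + 1) : ℕ) + (Fin.last (k + 1) : ℕ)) = 1 :=
      Even.neg_one_pow ⟨_, rfl⟩
    rw [h2, h3]
    ring
  · intro j _
    rw [h]; ring

lemma det_eq_of_succ_rows {k : ℕ} {A B : Mat (k + 1)} (c : Fin k → ℝ)
    (hl : ∀ j, A (Fin.last k) j = B (Fin.last k) j)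
    (h : ∀ i j, A (Fin.castSucc i) j = B (Fin.castSucc i) j + c i * A i.succ j) :
    A.det = B.det := by
  rw [← Matrix.det_submatrix_equiv_self Fin.revPerm A,
    ← Matrix.det_submatrix_equiv_self Fin.revPerm B]
  refine Matrix.det_eq_of_forall_row_eq_smul_add_pred (fun i => c i.rev) (fun j => ?_)
    fun i j => ?_
  · simpa using hl j.rev
  · simpa [Fin.rev_succ, Fin.rev_castSucc] using h i.rev j.rev

lemma exists_castSucc_comp {n k : ℕ} {f : Fin k → Fin (n + 1)} (hf : StrictMono f)
    (h : ∀ a, f a ≠ Fin.last n) : ∃ f' : Fin k → Fin n, StrictMono f' ∧ f = Fin.castSucc ∘ f' := by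
  refine ⟨fun a => (f a).castPred (h a), fun a b hab => ?_, ?_⟩
  · exact Fin.castPred_lt_castPred_iff.2 (hf hab)
  · ext a; simp

lemma tnn_of_corner {n : ℕ} {x : Mat (n + 1)} (h : tnn (x.submatrix Fin.castSucc Fin.castSucc))
    (hr : ∀ j : Fin n, x (Fin.last n) j.castSucc = 0)
    (hc : ∀ i : Fin n, x i.castSucc (Fin.last n) = 0)
    (hl : x (Fin.last n) (Fin.last n) = 1) : tnn x := by
  intro k f g hf hg
  have hrow : ∀ j, j ≠ Fin.last n → x (Fin.last n) j = 0 := fun j hj => by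
    obtain ⟨j, rfl⟩ := Fin.exists_castSucc_eq.2 hj; exact hr j
  have hcol : ∀ j, j ≠ Fin.last n → x j (Fin.last n) = 0 := fun j hj => by
    obtain ⟨j, rfl⟩ := Fin.exists_castSucc_eq.2 hj; exact hc j
  by_cases h1 : ∃ a, f a = Fin.last n
  · obtain ⟨a, ha⟩ := h1
    by_cases h2 : ∃ b, g b = Fin.last n
    · obtain ⟨b, hb⟩ := h2
      cases k with
      | zero => exact a.elim0
      | succ k =>
      have key : ∀ {f : Fin (k + 1) → Fin (n + 1)} (_ : StrictMono f) {a : Fin (k + 1)}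
          (_ : f a = Fin.last n),
          f (Fin.last k) = Fin.last n ∧
            ∃ f' : Fin k → Fin n, StrictMono f' ∧ f ∘ Fin.castSucc = Fin.castSucc ∘ f' := by
        intro f hf a ha
        have e : f (Fin.last k) = Fin.last n :=
          le_antisymm (Fin.le_last _) (ha ▸ hf.monotone (Fin.le_last a))
        refine ⟨e, exists_castSucc_comp (hf.comp Fin.strictMono_castSucc) fun c => ?_⟩
        have := hf (Fin.castSucc_lt_last c)
        rw [e] at this
        exact this.ne
      obtain ⟨hfl, f', hf', ef⟩ := key hf ha
      obtain ⟨hgl, g', hg', eg⟩ := key hg hb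
      rw [Matrix.det_succ_row _ (Fin.last k), Fin.sum_univ_castSucc, Finset.sum_eq_zero]
      · rw [Fin.succAbove_last, Matrix.submatrix_apply, hfl, hgl, hl, Matrix.submatrix_submatrix,
          ef, eg]
        have := h k f' g' hf' hg'
        rw [Matrix.submatrix_submatrix] at this
        rw [Even.neg_one_pow ⟨_, rfl⟩]
        linarith
      · intro j _
        rw [Matrix.submatrix_apply, hfl, hrow]
        · ring
        · have := hg (Fin.castSucc_lt_last j)
          rw [hgl] at this
          exact this.ne
    · rw [Matrix.det_eq_zero_of_row_eq_zero a]
      intro j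
      rw [Matrix.submatrix_apply, ha, hrow]
      exact fun e => h2 ⟨j, e⟩
  · by_cases h2 : ∃ b, g b = Fin.last n
    · obtain ⟨b, hb⟩ := h2
      rw [Matrix.det_eq_zero_of_column_eq_zero b]
      intro j
      rw [Matrix.submatrix_apply, hb, hcol]
      exact fun e => h1 ⟨j, e⟩
    · obtain ⟨f', hf', rfl⟩ := exists_castSucc_comp hf fun a e => h1 ⟨a, e⟩
      obtain ⟨g', hg', rfl⟩ := exists_castSucc_comp hg fun a e => h2 ⟨a, e⟩
      exact h k f' g' hf' hg'

lemma det_exchange {n k : ℕ} {z : Mat n} (hz : upperUni z) (hk : k + 1 ≤ n) (A : Fin k → Fin n)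
    {b : Fin n} (c : Fin n) (hA : ∀ a, A a < b) :
    (z.submatrix (Fin.snoc (α := fun _ => Fin n) (Fin.castLE hk) b)
      (Fin.snoc (α := fun _ => Fin n) (Fin.snoc (α := fun _ => Fin n) A b) c)).det =
    z b c * flag z hk (Fin.snoc (α := fun _ => Fin n) A b) -
      flag z hk (Fin.snoc (α := fun _ => Fin n) A c) := by
  rw [det_last_row]
  · simp only [Matrix.submatrix_apply, Fin.snoc_last, Fin.snoc_castSucc, hz.1, one_mul,
      Matrix.submatrix_submatrix]
    unfold flag
    have e1 : Fin.snoc (α := fun _ => Fin n) (Fin.castLE hk) b ∘ Fin.castSucc = Fin.castLE hk := by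
      ext a; simp
    have e2 : Fin.snoc (α := fun _ => Fin n) (Fin.snoc (α := fun _ => Fin n) A b) c ∘
        Fin.castSucc = Fin.snoc (α := fun _ => Fin n) A b := by
      ext a; simp
    have e3 : Fin.snoc (α := fun _ => Fin n) (Fin.snoc (α := fun _ => Fin n) A b) c ∘
        Fin.snoc (α := fun _ => Fin (k + 2)) (fun j => j.castSucc.castSucc) (Fin.last (k + 1)) =
        Fin.snoc (α := fun _ => Fin n) A c := by
      ext a
      induction a using Fin.lastCases with
      | last => simp
      | cast a => simp
    rw [e1, e2, e3]
  · intro j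
    simp only [Matrix.submatrix_apply, Fin.snoc_last, Fin.snoc_castSucc]
    exact hz.2 _ _ (hA j)

lemma flagNonneg.apply_nonneg {n : ℕ} {z : Mat n} (hz : upperUni z) (h : flagNonneg z)
    {i j : Fin n} (hij : i ≤ j) : 0 ≤ z i j := by
  rw [← flag_colsWith i.2 hz]
  exact h _ _ _ (strictMono_colsWith i.2 hij)

lemma flagNonneg.zero_pattern {n : ℕ} {z : Mat (n + 1)} (hz : upperUni z) (h : flagNonneg z)
    (i : Fin n) (h0 : z i.succ (Fin.last n) = 0) : z i.castSucc (Fin.last n) = 0 := by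
  have hlt : i.succ < Fin.last n := by
    refine lt_of_le_of_ne (Fin.le_last _) fun e => ?_
    rw [e, hz.1] at h0
    exact one_ne_zero h0
  have hlt' : (i : ℕ) + 1 < n := by simpa [Fin.lt_def] using hlt
  have hk : (i : ℕ) + 1 ≤ n + 1 := by omega
  have hA : ∀ a : Fin (i : ℕ), Fin.castLE (by omega : (i : ℕ) ≤ n + 1) a < i.succ := by
    intro a
    rw [Fin.lt_def]
    simp only [Fin.val_castLE, Fin.val_succ]
    omega
  have e := det_exchange hz hk (fun a : Fin (i : ℕ) => Fin.castLE (by omega) a)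
    (b := i.succ) (Fin.last n) hA
  have e1 : (Fin.snoc (α := fun _ => Fin (n + 1)) (Fin.castLE hk) i.succ) =
      Fin.castLE (by omega : (i : ℕ) + 2 ≤ n + 1) := by
    ext a
    induction a using Fin.lastCases with
    | last => simp
    | cast a => simp
  have e2 : flag z hk (Fin.snoc (α := fun _ => Fin (n + 1))
      (fun a : Fin (i : ℕ) => Fin.castLE (by omega) a) (Fin.last n)) =
      z i.castSucc (Fin.last n) := flag_colsWith hk hz (Fin.last n)
  rw [e1, e2, h0, zero_mul, zero_sub] at e
  have h1 := h _ (by omega : (i : ℕ) + 2 ≤ n + 1) _ (strictMono_snoc (v := Fin.last n)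
    (strictMono_snoc (v := i.succ) (Fin.strictMono_castLE (by omega : (i : ℕ) ≤ n + 1)) hA) (by
      intro a
      induction a using Fin.lastCases with
      | last => simpa using hlt
      | cast a => simpa using (hA a).trans hlt))
  unfold flag at h1
  have h2 := h.apply_nonneg hz (Fin.le_last i.castSucc)
  have h3 : 0 ≤ - z i.castSucc (Fin.last n) := e ▸ h1
  linarith

/-- The matrix obtained by subtracting from each row a multiple of the next one. -/
def reduceRows {n : ℕ} (z : Mat (n + 1)) (c : Fin n → ℝ) : Mat (n + 1) :=
  Matrix.of fun i j => Fin.lastCases (motive := fun _ => ℝ) (z (Fin.last n) j)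
    (fun i => z i.castSucc j - c i * z i.succ j) i

@[simp] lemma reduceRows_last {n : ℕ} (z : Mat (n + 1)) (c : Fin n → ℝ) :
    reduceRows z c (Fin.last n) = z (Fin.last n) := by
  ext j; simp [reduceRows]

@[simp] lemma reduceRows_castSucc {n : ℕ} (z : Mat (n + 1)) (c : Fin n → ℝ) (i : Fin n) :
    reduceRows z c i.castSucc = z i.castSucc - c i • z i.succ := by
  ext j; simp [reduceRows]

lemma tnn_of_reduceRows {n : ℕ} {z : Mat (n + 1)} {c : Fin n → ℝ} (hc : ∀ i, 0 ≤ c i)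
    (h : tnn (reduceRows z c)) : tnn z := by
  have key : ∀ d t : ℕ, t + d = n →
      tnn (Matrix.of fun i : Fin (n + 1) => if (i : ℕ) < t then reduceRows z c i else z i) := by
    intro d
    induction d with
    | zero =>
      intro t ht
      convert h using 1
      ext i j
      simp only [Matrix.of_apply]
      split_ifs with hi
      · rfl
      · have : i = Fin.last n := by
          ext; simp only [Fin.val_last]; have := i.2; omega
        rw [this, reduceRows_last]
    | succ d ih =>
      intro t ht
      have h1 := (ih (t + 1) (by omega)).rowOp (i := (⟨t, by omega⟩ : Fin n).castSucc)
        (j := (⟨t, by omega⟩ : Fin n).succ) (by simp) (hc ⟨t, by omega⟩)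
      convert h1 using 1
      ext i j
      by_cases hi : i = (⟨t, by omega⟩ : Fin n).castSucc
      · subst hi
        rw [Matrix.updateRow_self]
        simp only [Matrix.of_apply, Pi.add_apply, Pi.smul_apply, Fin.val_castSucc, Fin.val_succ,
          lt_irrefl, if_false, Nat.lt_succ_self, if_true, reduceRows_castSucc, Pi.sub_apply,
          smul_eq_mul]
        ring
      · rw [Matrix.updateRow_ne hi]
        have : (i : ℕ) ≠ t := fun e => hi (Fin.ext e)
        simp only [Matrix.of_apply]
        have e : ((i : ℕ) < t) ↔ (i : ℕ) < t + 1 := by omega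
        simp only [e]
  have := key n 0 (by omega)
  convert this using 1
  ext i j
  simp

lemma flag_snoc_last {n k : ℕ} (z : Mat (n + 1)) (c : Fin n → ℝ)
    (h0 : ∀ i : Fin n, reduceRows z c i.castSucc (Fin.last n) = 0) (hk : k ≤ n)
    (J : Fin k → Fin n) :
    flag z (Nat.succ_le_succ hk) (Fin.snoc (α := fun _ => Fin (n + 1)) (Fin.castSucc ∘ J)
      (Fin.last n)) =
    flag ((reduceRows z c).submatrix Fin.castSucc Fin.castSucc) hk J *
      z ⟨k, Nat.lt_succ_of_le hk⟩ (Fin.last n) := by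
  set J' : Fin (k + 1) → Fin (n + 1) :=
    Fin.snoc (α := fun _ => Fin (n + 1)) (Fin.castSucc ∘ J) (Fin.last n) with hJ'
  set r : Fin (k + 1) → Fin (n + 1) := Fin.castLE (Nat.succ_le_succ hk) with hr
  have hr1 : ∀ i : Fin k, r i.castSucc = (Fin.castLE hk i).castSucc := fun i => rfl
  have hr2 : ∀ i : Fin k, r i.succ = (Fin.castLE hk i).succ := fun i => rfl
  let B : Mat (k + 1) := Matrix.of fun i j => Fin.lastCases (motive := fun _ => ℝ)
    (z (r (Fin.last k)) (J' j)) (fun i => reduceRows z c (r i.castSucc) (J' j)) i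
  have hB1 : ∀ i j, B (Fin.castSucc i) j = reduceRows z c (r i.castSucc) (J' j) := by
    intro i j; simp [B]
  have hB2 : ∀ j, B (Fin.last k) j = z (r (Fin.last k)) (J' j) := by
    intro j; simp [B]
  have h1 : flag z (Nat.succ_le_succ hk) J' = B.det := by
    refine det_eq_of_succ_rows (fun i => c (Fin.castLE hk i)) (fun j => (hB2 j).symm) fun i j => ?_
    rw [hB1, hr1, reduceRows_castSucc]
    simp only [Matrix.submatrix_apply, Pi.sub_apply, Pi.smul_apply, smul_eq_mul]
    have e1 : Fin.castLE (Nat.succ_le_succ hk) i.castSucc = (Fin.castLE hk i).castSucc := rfl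
    have e2 : Fin.castLE (Nat.succ_le_succ hk) i.succ = (Fin.castLE hk i).succ := rfl
    rw [e1, e2]
    ring
  rw [h1, Matrix.det_succ_column _ (Fin.last k), Fin.sum_univ_castSucc, Finset.sum_eq_zero]
  · rw [Even.neg_one_pow ⟨_, rfl⟩, hB2, Fin.succAbove_last, zero_add, one_mul, mul_comm]
    have e3 : J' (Fin.last k) = Fin.last n := by simp [hJ']
    rw [e3]
    congr 1
    unfold flag
    congr 1
    ext i j
    rw [Matrix.submatrix_apply, hB1, hr1]
    simp [hJ']
  · intro i _
    have e3 : J' (Fin.last k) = Fin.last n := by simp [hJ']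
    rw [hB1, e3, hr1, h0]
    ring

theorem flagNonneg.tnn : ∀ {n : ℕ} {z : Mat n}, upperUni z → flagNonneg z → tnn z := by
  intro n
  induction n with
  | zero =>
    intro z _ _ k f g hf hg
    cases k with
    | zero => simp
    | succ k => exact (f 0).elim0
  | succ n ih =>
    intro z hz h
    let c : Fin n → ℝ := fun i => z i.castSucc (Fin.last n) / z i.succ (Fin.last n)
    have hpos : ∀ i, 0 ≤ z i (Fin.last n) := fun i => h.apply_nonneg hz (Fin.le_last i)
    have hc : ∀ i, 0 ≤ c i := fun i => div_nonneg (hpos _) (hpos _)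
    have h0 : ∀ i : Fin n, reduceRows z c i.castSucc (Fin.last n) = 0 := by
      intro i
      simp only [reduceRows_castSucc, Pi.sub_apply, Pi.smul_apply, smul_eq_mul, c]
      by_cases hi : z i.succ (Fin.last n) = 0
      · rw [h.zero_pattern hz i hi, hi]; simp
      · rw [div_mul_cancel₀ _ hi, sub_self]
    refine tnn_of_reduceRows hc (tnn_of_corner (ih ?_ ?_) ?_ h0 ?_)
    · refine ⟨fun i => ?_, fun i j hij => ?_⟩
      · rw [Matrix.submatrix_apply, reduceRows_castSucc, Pi.sub_apply, Pi.smul_apply, hz.1,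
          hz.2 _ _ Fin.castSucc_lt_succ]
        simp
      · rw [Matrix.submatrix_apply, reduceRows_castSucc, Pi.sub_apply, Pi.smul_apply,
          hz.2 _ _ (Fin.castSucc_lt_castSucc_iff.2 hij),
          hz.2 _ _ ((Fin.castSucc_lt_castSucc_iff.2 hij).trans Fin.castSucc_lt_succ)]
        simp
    · intro k hk J hJ
      have e := flag_snoc_last z c h0 hk J
      have h1 := h _ (Nat.succ_le_succ hk) _ (strictMono_snoc (v := Fin.last n)
        (Fin.strictMono_castSucc.comp hJ) fun i => Fin.castSucc_lt_last _)
      rw [e] at h1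
      rcases (hpos ⟨k, Nat.lt_succ_of_le hk⟩).eq_or_lt with h2 | h2
      · have h3 : ∀ d i : ℕ, ∀ hi : i + d = k, z ⟨i, by omega⟩ (Fin.last n) = 0 := by
          intro d
          induction d with
          | zero => intro i hi; simp only [Nat.add_zero] at hi; subst hi; exact h2.symm
          | succ d ihd =>
            intro i hi
            exact h.zero_pattern hz ⟨i, by omega⟩ (ihd (i + 1) (by omega))
        have h4 : ∀ i : Fin k, c (Fin.castLE hk i) = 0 := by
          intro i
          have : z (Fin.castLE hk i).castSucc (Fin.last n) = 0 :=
            h3 (k - i) i (by have := i.2; omega)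
          simp only [c, this, zero_div]
        have h5 : flag ((reduceRows z c).submatrix Fin.castSucc Fin.castSucc) hk J =
            flag z (hk.trans (Nat.le_succ n)) (Fin.castSucc ∘ J) := by
          unfold flag
          congr 1
          ext i j
          simp only [Matrix.submatrix_apply, reduceRows_castSucc, h4]
          simp
        rw [h5]
        exact h _ _ _ (Fin.strictMono_castSucc.comp hJ)
      · exact nonneg_of_mul_nonneg_left h1 h2
    · intro j
      rw [reduceRows_last]
      exact hz.2 _ _ (Fin.castSucc_lt_last j)
    · rw [reduceRows_last]
      exact hz.1 _

lemma det_plucker {ι : Type*} [Fintype ι] [DecidableEq ι] (A : Matrix ι ι ℝ) {i j : ι}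
    (hij : i ≠ j) (a b m e : ι → ℝ) :
    ((A.updateCol i b).updateCol j e).det * ((A.updateCol i a).updateCol j m).det =
      ((A.updateCol i a).updateCol j e).det * ((A.updateCol i b).updateCol j m).det +
      ((A.updateCol i m).updateCol j e).det * ((A.updateCol i a).updateCol j b).det := by
  have hswap : ∀ x y : ι → ℝ, ((A.updateCol i x).updateCol j y).det =
      - ((A.updateCol i y).updateCol j x).det := by
    intro x y
    have h1 := Matrix.det_permute' (Equiv.swap i j) ((A.updateCol i y).updateCol j x)
    rw [Equiv.Perm.sign_swap hij] at h1
    have h2 : ((A.updateCol i y).updateCol j x).submatrix id (Equiv.swap i j) =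
        (A.updateCol i x).updateCol j y := by
      ext r c
      simp only [Matrix.submatrix_apply, Matrix.updateCol_apply, id]
      by_cases hi : c = i
      · subst hi; simp [hij]
      · by_cases hj : c = j
        · subst hj; simp [hij]
        · simp [Equiv.swap_apply_of_ne_of_ne hi hj, hi, hj]
    rw [h2] at h1
    rw [h1]; simp
  set D := (A.updateCol i a).updateCol j b with hD
  set E := A.updateCol j e with hE
  have hEx : ∀ x, E.cramer x i = ((A.updateCol i x).updateCol j e).det := by
    intro x
    rw [Matrix.cramer_apply, hE, Matrix.updateCol_comm _ hij]
  have h1 := Matrix.mulVec_cramer D m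
  have h2 := congrFun (congrArg E.cramer h1) i
  have h3 : D *ᵥ D.cramer m = ∑ k, D.cramer m k • D.col k := by
    ext r
    simp [Matrix.mulVec, dotProduct, mul_comm]
  rw [h3, map_sum, map_smul, Finset.sum_apply, Pi.smul_apply, hEx,
    ← Finset.sum_subset (Finset.subset_univ {i, j}), Finset.sum_pair hij] at h2
  · have c1 : D.col i = a := by ext r; simp [hD, hij]
    have c2 : D.col j = b := by ext r; simp [hD]
    have d1 : D.cramer m i = ((A.updateCol i m).updateCol j b).det := by
      rw [Matrix.cramer_apply, hD, Matrix.updateCol_comm _ hij.symm, Matrix.updateCol_idem,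
        Matrix.updateCol_comm _ hij]
    have d2 : D.cramer m j = ((A.updateCol i a).updateCol j m).det := by
      rw [Matrix.cramer_apply, hD, Matrix.updateCol_idem]
    rw [map_smul, map_smul, Pi.smul_apply, Pi.smul_apply, hEx, hEx, c1, c2, d1, d2,
      hswap m b] at h2
    simp only [smul_eq_mul] at h2
    linarith
  · intro k _ hk
    simp only [Finset.mem_insert, Finset.mem_singleton, not_or] at hk
    rw [map_smul, Matrix.cramer_row_self E (D.col k) k, Pi.smul_apply,
      Pi.single_eq_of_ne' hk.1, smul_zero]
    intro r
    simp [hD, hE, hk.1, hk.2]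

lemma flag_insertNth {n k : ℕ} (z : Mat n) (hk : k + 1 ≤ n) (S : Fin k → Fin n)
    (p : Fin (k + 1)) (v : Fin n) : flag z hk (p.insertNth (α := fun _ => Fin n) v S) =
      (-1) ^ ((p : ℕ) + k) * flag z hk (Fin.snoc (α := fun _ => Fin n) S v) := by
  unfold flag
  rw [Matrix.det_succ_column _ p, Matrix.det_succ_column _ (Fin.last k), Finset.mul_sum]
  refine Finset.sum_congr rfl fun i _ => ?_
  have e1 : p.insertNth (α := fun _ => Fin n) v S ∘ p.succAbove = S := by
    ext a; simp
  have e2 : Fin.snoc (α := fun _ => Fin n) S v ∘ (Fin.last k).succAbove = S := by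
    ext a; simp
  rw [Matrix.submatrix_submatrix, Matrix.submatrix_submatrix, e1, e2, Matrix.submatrix_apply,
    Matrix.submatrix_apply, Fin.insertNth_apply_same, Fin.snoc_last, Fin.val_last]
  have e3 : ((-1 : ℝ)) ^ ((i : ℕ) + p) = (-1) ^ ((p : ℕ) + k) * (-1) ^ ((i : ℕ) + k) := by
    rw [← pow_add, show (p : ℕ) + k + (i + k) = (i + p) + 2 * k by ring,
      pow_add _ ((i : ℕ) + p), pow_mul]
    simp
  rw [e3]
  ring

lemma flag_plucker {n k : ℕ} (z : Mat n) (hk : k + 2 ≤ n) (S : Fin k → Fin n)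
    (t : Fin (k + 1)) (a b m : Fin n) :
    flag z (Nat.le_of_succ_le hk) (t.insertNth (α := fun _ => Fin n) b S) *
      flag z hk (Fin.snoc (α := fun _ => Fin n) (t.insertNth (α := fun _ => Fin n) a S) m) =
    flag z (Nat.le_of_succ_le hk) (t.insertNth (α := fun _ => Fin n) a S) *
      flag z hk (Fin.snoc (α := fun _ => Fin n) (t.insertNth (α := fun _ => Fin n) b S) m) +
    flag z (Nat.le_of_succ_le hk) (t.insertNth (α := fun _ => Fin n) m S) *
      flag z hk (Fin.snoc (α := fun _ => Fin n) (t.insertNth (α := fun _ => Fin n) a S) b) := by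
  set A : Mat (k + 2) := z.submatrix (Fin.castLE hk)
    (Fin.snoc (α := fun _ => Fin n) (t.insertNth (α := fun _ => Fin n) a S) b) with hA
  let col : Fin n → Fin (k + 2) → ℝ := fun v r => z (Fin.castLE hk r) v
  have hij : t.castSucc ≠ Fin.last (k + 1) := (Fin.castSucc_lt_last t).ne
  have hM : ∀ v y, ∀ r c, ((A.updateCol t.castSucc (col v)).updateCol (Fin.last (k + 1)) y) r
      (Fin.castSucc c) = z (Fin.castLE hk r) (t.insertNth (α := fun _ => Fin n) v S c) := by
    intro v y r c
    rw [Matrix.updateCol_ne (Fin.castSucc_lt_last c).ne]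
    rcases Fin.eq_self_or_eq_succAbove t c with rfl | ⟨c, rfl⟩
    · rw [Matrix.updateCol_self]; simp [col]
    · rw [Matrix.updateCol_ne, hA, Matrix.submatrix_apply, Fin.snoc_castSucc,
        Fin.insertNth_apply_succAbove, Fin.insertNth_apply_succAbove]
      intro h
      exact Fin.succAbove_ne t c (Fin.castSucc_injective _ h)
  have hg : ∀ v w, flag z hk (Fin.snoc (α := fun _ => Fin n)
      (t.insertNth (α := fun _ => Fin n) v S) w) =
      ((A.updateCol t.castSucc (col v)).updateCol (Fin.last (k + 1)) (col w)).det := by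
    intro v w
    unfold flag
    congr 1
    ext r c
    induction c using Fin.lastCases with
    | last => rw [Matrix.updateCol_self]; simp [col]
    | cast c => rw [hM]; simp
  have hf : ∀ v, flag z (Nat.le_of_succ_le hk) (t.insertNth (α := fun _ => Fin n) v S) =
      ((A.updateCol t.castSucc (col v)).updateCol (Fin.last (k + 1))
        (Pi.single (Fin.last (k + 1)) 1)).det := by
    intro v
    rw [Matrix.det_succ_column _ (Fin.last (k + 1)), Fin.sum_univ_castSucc, Finset.sum_eq_zero]
    · rw [Even.neg_one_pow ⟨_, rfl⟩, Matrix.updateCol_self, Pi.single_eq_same, Fin.succAbove_last,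
        zero_add, one_mul, one_mul]
      unfold flag
      congr 1
      ext r c
      rw [Matrix.submatrix_apply, Matrix.submatrix_apply, hM]
      rfl
    · intro r _
      rw [Matrix.updateCol_self, Pi.single_eq_of_ne (Fin.castSucc_lt_last r).ne]
      ring
  rw [hf, hf, hf, hg, hg, hg]
  exact det_plucker A hij _ _ _ _

lemma flag_pos_lower_entry {n k : ℕ} {z : Mat n} (h : flagNonneg z) (hk : k + 2 ≤ n)
    (S : Fin k → Fin n) (t : Fin (k + 1)) {a b m : Fin n} (hab : a < b)
    (ha : StrictMono (t.insertNth (α := fun _ => Fin n) a S))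
    (hb : StrictMono (t.insertNth (α := fun _ => Fin n) b S))
    (hm : ∀ i, t.insertNth (α := fun _ => Fin n) b S i < m)
    (hfa : 0 < flag z (Nat.le_of_succ_le hk) (t.insertNth (α := fun _ => Fin n) a S))
    (hfb : 0 < flag z (Nat.le_of_succ_le hk) (t.insertNth (α := fun _ => Fin n) b S))
    (hg : 0 < flag z hk (Fin.snoc (α := fun _ => Fin n)
      (t.insertNth (α := fun _ => Fin n) b S) m)) :
    0 < flag z hk (Fin.snoc (α := fun _ => Fin n)
      (t.insertNth (α := fun _ => Fin n) a S) m) := by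
  have hp := flag_plucker z hk S t a b m
  have hS : StrictMono S := by
    have := hb.comp (Fin.strictMono_succAbove t)
    convert this using 1
    ext i; simp
  have h1 : 0 ≤ flag z (Nat.le_of_succ_le hk) (Fin.snoc (α := fun _ => Fin n) S m) := by
    refine h _ _ _ (strictMono_snoc hS fun i => ?_)
    have := hm (t.succAbove i)
    rwa [Fin.insertNth_apply_succAbove] at this
  have h2 : 0 ≤ flag z hk (t.succ.insertNth (α := fun _ => Fin n) b
      (t.insertNth (α := fun _ => Fin n) a S)) := by
    refine h _ _ _ ((Fin.strictMono_insertNth_iff _ _ _).2 ⟨ha, fun i hi => ?_, fun i hi => ?_⟩)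
    · have hi' : i ≤ t := by
        rw [Fin.lt_def] at hi; rw [Fin.le_def]
        simp only [Fin.val_castSucc, Fin.val_succ] at hi; omega
      have := ha.monotone hi'
      rw [Fin.insertNth_apply_same] at this
      exact this.trans_lt hab
    · have hi' : t < i := by
        rw [Fin.le_def] at hi; rw [Fin.lt_def]
        simp only [Fin.val_castSucc, Fin.val_succ] at hi; omega
      have := hb hi'
      rw [Fin.insertNth_apply_same] at this
      rcases Fin.eq_self_or_eq_succAbove t i with rfl | ⟨i, rfl⟩
      · exact absurd hi' (lt_irrefl _)
      · rwa [Fin.insertNth_apply_succAbove] at this ⊢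
  rw [flag_insertNth] at h2
  rw [flag_insertNth z _ S t m] at hp
  have h3 : 0 ≤ (-1 : ℝ) ^ ((t : ℕ) + k) * flag z (Nat.le_of_succ_le hk)
      (Fin.snoc (α := fun _ => Fin n) S m) * flag z hk (Fin.snoc (α := fun _ => Fin n)
      (t.insertNth (α := fun _ => Fin n) a S) b) := by
    have e : (-1 : ℝ) ^ ((t.succ : ℕ) + (k + 1)) = (-1) ^ ((t : ℕ) + k) := by
      rw [Fin.val_succ, show (t : ℕ) + 1 + (k + 1) = t + k + 2 by ring, pow_add]; simp
    rw [e] at h2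
    have := mul_nonneg h1 h2
    calc _ ≤ _ := this
      _ = _ := by ring
  have h4 := mul_pos hfa hg
  by_contra h5
  have h6 := mul_nonpos_of_nonneg_of_nonpos hfb.le (not_lt.1 h5)
  linarith

lemma val_le_of_strictMono {n k : ℕ} {J : Fin k → Fin n} (hJ : StrictMono J) :
    ∀ i : Fin k, (i : ℕ) ≤ J i := by
  rintro ⟨i, hi⟩
  induction i with
  | zero => exact Nat.zero_le _
  | succ i ih =>
    have h1 := ih (by omega)
    have h2 : J ⟨i, by omega⟩ < J ⟨i + 1, hi⟩ := hJ (by simp [Fin.lt_def])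
    rw [Fin.lt_def] at h2
    simp only at h1 ⊢
    omega

lemma eq_castLE_of_strictMono {n k : ℕ} (hk : k + 1 ≤ n) {J : Fin (k + 1) → Fin n}
    (hJ : StrictMono J) (hl : (J (Fin.last k) : ℕ) ≤ k) : J = Fin.castLE hk := by
  have h1 : ∀ d i : ℕ, ∀ hi : i + d = k, (J ⟨i, by omega⟩ : ℕ) ≤ i := by
    intro d
    induction d with
    | zero => intro i hi; simp only [Nat.add_zero] at hi; subst hi; exact hl
    | succ d ih =>
      intro i hi
      have h2 := ih (i + 1) (by omega)
      have h3 : J ⟨i, by omega⟩ < J ⟨i + 1, by omega⟩ := hJ (by simp [Fin.lt_def])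
      rw [Fin.lt_def] at h3
      omega
  ext i
  exact le_antisymm (h1 (k - i) i (by have := i.2; omega)) (val_le_of_strictMono hJ i)

theorem flag_pos_of_le {n : ℕ} {z : Mat n} (hz : upperUni z) (h : tnn z) :
    ∀ {k : ℕ} (hk : k ≤ n) {M J : Fin k → Fin n}, StrictMono M → StrictMono J → J ≤ M →
      0 < flag z hk M → 0 < flag z hk J := by
  intro k
  induction k with
  | zero =>
    intro hk M J _ _ _ _
    unfold flag
    simp
  | succ k ih =>
    intro hk M J hM hJ hJM hpos
    have hk' : k ≤ n := Nat.le_of_succ_le hk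
    have hlow : ∀ A : Fin k → Fin n, StrictMono A → A ≤ M ∘ Fin.castSucc → 0 < flag z hk' A := by
      intro A hA hAM
      have h1 := hpos.ne'
      unfold flag at h1
      rw [Matrix.det_succ_row _ (Fin.last k)] at h1
      obtain ⟨c, -, hc⟩ := Finset.exists_ne_zero_of_sum_ne_zero h1
      have h2 : flag z hk' (M ∘ c.succAbove) ≠ 0 := by
        intro h0
        refine hc (mul_eq_zero_of_right _ ?_)
        rw [← h0, Fin.succAbove_last, Matrix.submatrix_submatrix]
        rfl
      have h3 : StrictMono (M ∘ c.succAbove) := hM.comp (Fin.strictMono_succAbove c)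
      refine ih hk' h3 hA (fun i => (hAM i).trans (hM.monotone ?_))
        (lt_of_le_of_ne (h.flagNonneg _ _ _ h3) h2.symm)
      rw [Fin.succAbove]
      split_ifs
      · exact le_rfl
      · exact Fin.castSucc_le_succ i
    have hmix : ∀ t : ℕ, t ≤ k → 0 < flag z hk (Fin.snoc (α := fun _ => Fin n)
        (fun i : Fin k => if (i : ℕ) < t then J i.castSucc else M i.castSucc)
        (M (Fin.last k))) := by
      have hmono : ∀ t : ℕ, StrictMono
          (fun i : Fin k => if (i : ℕ) < t then J i.castSucc else M i.castSucc) := by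
        intro t a b hab
        have h1 : J a.castSucc < J b.castSucc := hJ (Fin.castSucc_lt_castSucc_iff.2 hab)
        have h2 : M a.castSucc < M b.castSucc := hM (Fin.castSucc_lt_castSucc_iff.2 hab)
        have h3 := hJM a.castSucc
        have h4 : (a : ℕ) < b := hab
        simp only
        split_ifs with ha hb hb
        · exact h1
        · exact h3.trans_lt h2
        · omega
        · exact h2
      have hle : ∀ t : ℕ, (fun i : Fin k => if (i : ℕ) < t then J i.castSucc else M i.castSucc) ≤
          M ∘ Fin.castSucc := by
        intro t i
        simp only [Function.comp]
        split_ifs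
        · exact hJM _
        · exact le_rfl
      intro t
      induction t with
      | zero =>
        intro _
        convert hpos using 2
        ext i
        induction i using Fin.lastCases with
        | last => simp
        | cast i => simp
      | succ t iht =>
        intro ht
        have hprev := iht (by omega)
        obtain ⟨k, rfl⟩ : ∃ k', k = k' + 1 := ⟨k - 1, by omega⟩
        set X : ℕ → Fin (k + 1) → Fin n := fun t i =>
          if (i : ℕ) < t then J i.castSucc else M i.castSucc with hX
        let p : Fin (k + 1) := ⟨t, ht⟩
        have e1 : X t = p.insertNth (α := fun _ => Fin n) (M p.castSucc) (X t ∘ p.succAbove) := by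
          ext i
          rcases Fin.eq_self_or_eq_succAbove p i with rfl | ⟨i, rfl⟩
          · simp [hX, p]
          · simp
        have e2 : X (t + 1) =
            p.insertNth (α := fun _ => Fin n) (J p.castSucc) (X t ∘ p.succAbove) := by
          ext i
          rcases Fin.eq_self_or_eq_succAbove p i with rfl | ⟨i, rfl⟩
          · simp [hX, p]
          · have h1 : ((p.succAbove i : Fin (k + 1)) : ℕ) ≠ t := fun e =>
              Fin.succAbove_ne p i (Fin.ext e)
            have h2 : ((p.succAbove i : Fin (k + 1)) : ℕ) < t + 1 ↔
              ((p.succAbove i : Fin (k + 1)) : ℕ) < t := by omega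
            simp [hX, h2]
        change 0 < flag z hk (Fin.snoc (α := fun _ => Fin n) (X (t + 1)) _)
        change 0 < flag z hk (Fin.snoc (α := fun _ => Fin n) (X t) _) at hprev
        rcases (hJM p.castSucc).eq_or_lt with he | hlt
        · rw [e2, he, ← e1]
          exact hprev
        · have m1 := hmono t
          have m2 := hmono (t + 1)
          change StrictMono (X t) at m1
          change StrictMono (X (t + 1)) at m2
          have p1 := hlow _ m1 (hle t)
          have p2 := hlow _ m2 (hle (t + 1))
          have b1 : ∀ i, X t i < M (Fin.last (k + 1)) := fun i =>
            (hle t i).trans_lt (hM (Fin.castSucc_lt_last i))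
          rw [e1] at m1 p1 b1 hprev
          rw [e2] at m2 p2 ⊢
          exact flag_pos_lower_entry h.flagNonneg hk _ p hlt m2 m1 b1 p2 p1 hprev
    have h1 := hmix k le_rfl
    have e : (fun i : Fin k => if (i : ℕ) < k then J i.castSucc else M i.castSucc) =
        J ∘ Fin.castSucc := by
      ext i; simp
    rw [e] at h1
    have eJ : Fin.snoc (α := fun _ => Fin n) (J ∘ Fin.castSucc) (J (Fin.last k)) = J := by
      ext i
      induction i using Fin.lastCases with
      | last => simp
      | cast i => simp
    rcases (hJM (Fin.last k)).eq_or_lt with he | hlt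
    · rwa [← he, eJ] at h1
    · by_cases hl : (J (Fin.last k) : ℕ) ≤ k
      · rw [eq_castLE_of_strictMono hk hJ hl, hz.leading]
        exact one_pos
      · have hA : ∀ i, (J ∘ Fin.castSucc) i < J (Fin.last k) := fun i =>
          hJ (Fin.castSucc_lt_last i)
        have hdet := det_exchange hz hk (J ∘ Fin.castSucc) (M (Fin.last k)) hA
        rw [eJ] at hdet
        have h2 := h _ _ _ (strictMono_snoc (v := J (Fin.last k)) (Fin.strictMono_castLE hk)
          (fun i => by
            rw [Fin.lt_def, Fin.val_castLE]
            have := i.2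
            omega)) (strictMono_snoc (v := M (Fin.last k)) hJ fun i =>
              (hJ.monotone (Fin.le_last i)).trans_lt hlt)
        rw [hdet] at h2
        refine lt_of_le_of_ne (h.flagNonneg _ _ _ hJ) fun h0 => ?_
        rw [← h0] at h2
        linarith

lemma det_mul_eq_sum {k n : ℕ} (A : Matrix (Fin k) (Fin n) ℝ) (B : Matrix (Fin n) (Fin k) ℝ) :
    (A * B).det = ∑ f : Fin k → Fin n, (∏ i, A i (f i)) * (B.submatrix f id).det := by
  have h1 : (A * B).det = Matrix.detRowAlternating fun i => ∑ p, A i p • B p := by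
    change Matrix.det _ = Matrix.det _
    congr 1
    ext i j
    simp [Matrix.mul_apply]
  rw [h1]
  change (Matrix.detRowAlternating : (Fin k → ℝ) [⋀^Fin k]→ₗ[ℝ] ℝ).toMultilinearMap _ = _
  rw [MultilinearMap.map_sum]
  refine Finset.sum_congr rfl fun f _ => ?_
  rw [MultilinearMap.map_smul_univ]
  rfl

lemma factorial_mul_det_mul {k n : ℕ} (A : Matrix (Fin k) (Fin n) ℝ)
    (B : Matrix (Fin n) (Fin k) ℝ) : (k.factorial : ℝ) * (A * B).det =
      ∑ f : Fin k → Fin n, (A.submatrix id f).det * (B.submatrix f id).det := by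
  have h1 : ∀ σ : Equiv.Perm (Fin k), ((Equiv.Perm.sign σ : ℤ) : ℝ) *
      ∑ f : Fin k → Fin n, (∏ i, A (σ i) (f i)) * (B.submatrix f id).det = (A * B).det := by
    intro σ
    have h2 := det_mul_eq_sum (A.submatrix σ id) B
    have h3 : A.submatrix σ id * B = (A * B).submatrix σ id := rfl
    rw [h3, Matrix.det_permute] at h2
    simp only [Matrix.submatrix_apply, id] at h2
    rw [← h2, ← mul_assoc, ← Int.cast_mul, ← Units.val_mul, Int.units_mul_self]
    simp
  have h2 : (k.factorial : ℝ) * (A * B).det = ∑ σ : Equiv.Perm (Fin k), (A * B).det := by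
    rw [Finset.sum_const, Finset.card_univ, Fintype.card_perm, Fintype.card_fin, nsmul_eq_mul]
  rw [h2, ← Finset.sum_congr rfl fun σ _ => h1 σ]
  simp only [Finset.mul_sum]
  rw [Finset.sum_comm]
  refine Finset.sum_congr rfl fun f _ => ?_
  rw [Matrix.det_apply' (A.submatrix id f), Finset.sum_mul]
  refine Finset.sum_congr rfl fun σ _ => ?_
  simp only [Matrix.submatrix_apply, id]
  ring

lemma strictMono_comp_sort {n k : ℕ} {f : Fin k → Fin n} (hf : Function.Injective f) :
    StrictMono (f ∘ Tuple.sort f) :=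
  (Tuple.monotone_sort f).strictMono_of_injective (hf.comp (Tuple.sort f).injective)

lemma det_mul_pos {k n : ℕ} {A : Matrix (Fin k) (Fin n) ℝ} {B : Matrix (Fin n) (Fin k) ℝ}
    (hA : ∀ f, StrictMono f → 0 ≤ (A.submatrix id f).det)
    (hB : ∀ f, StrictMono f → 0 ≤ (B.submatrix f id).det)
    (f₀ : Fin k → Fin n) (hA₀ : 0 < (A.submatrix id f₀).det)
    (hB₀ : 0 < (B.submatrix f₀ id).det) : 0 < (A * B).det := by
  have h1 : 0 < (k.factorial : ℝ) * (A * B).det := by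
    rw [factorial_mul_det_mul]
    refine Finset.sum_pos' (fun f _ => ?_) ⟨f₀, Finset.mem_univ _, mul_pos hA₀ hB₀⟩
    by_cases hf : Function.Injective f
    · have h2 := strictMono_comp_sort hf
      have h3 := mul_nonneg (hA _ h2) (hB _ h2)
      have e1 : A.submatrix id (f ∘ Tuple.sort f) =
        (A.submatrix id f).submatrix id (Tuple.sort f) := rfl
      have e2 : B.submatrix (f ∘ Tuple.sort f) id =
        (B.submatrix f id).submatrix (Tuple.sort f) id := rfl
      rw [e1, e2, Matrix.det_permute', Matrix.det_permute] at h3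
      have e3 : (((Equiv.Perm.sign (Tuple.sort f) : ℤˣ) : ℤ) : ℝ) *
          (((Equiv.Perm.sign (Tuple.sort f) : ℤˣ) : ℤ) : ℝ) = 1 := by
        rw [← Int.cast_mul, ← Units.val_mul, Int.units_mul_self]; simp
      calc (0 : ℝ) ≤ _ := h3
        _ = (((Equiv.Perm.sign (Tuple.sort f) : ℤˣ) : ℤ) : ℝ) *
          (((Equiv.Perm.sign (Tuple.sort f) : ℤˣ) : ℤ) : ℝ) *
          ((A.submatrix id f).det * (B.submatrix f id).det) := by ring
        _ = _ := by rw [e3, one_mul]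
    · simp only [Function.Injective, not_forall] at hf
      obtain ⟨a, b, hab, hne⟩ := hf
      rw [Matrix.det_zero_of_column_eq hne, zero_mul]
      intro i
      simp [hab]
  exact pos_of_mul_pos_right h1 (Nat.cast_nonneg _)

/-- All minors of `q` on initial sets of columns are nonnegative, and the leading ones positive. -/
def colFlagNonneg {n : ℕ} (q : Mat n) : Prop :=
  ∀ (k : ℕ) (hk : k ≤ n), (∀ J : Fin k → Fin n, StrictMono J →
    0 ≤ (q.submatrix J (Fin.castLE hk)).det) ∧ 0 < flag q hk (Fin.castLE hk)

lemma hasGauss_mul_of_flagNonneg {n : ℕ} {y q : Mat n} (hy : upperUni y) (hf : flagNonneg y)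
    (hq : colFlagNonneg q) : hasGauss (y * q) := by
  refine hasGauss_of_leading fun k hk => ne_of_gt ?_
  have h1 : (y * q).submatrix (Fin.castLE hk) (Fin.castLE hk) =
    y.submatrix (Fin.castLE hk) id * q.submatrix id (Fin.castLE hk) := rfl
  unfold flag
  rw [h1]
  refine det_mul_pos (fun f hf' => hf k hk f hf') (fun f hf' => (hq k hk).1 f hf')
    (Fin.castLE hk) ?_ (hq k hk).2
  have := hy.leading hk
  unfold flag at this
  rw [Matrix.submatrix_submatrix]
  exact this ▸ one_pos

lemma permMat_mul_apply {n : ℕ} {ι : Type*} (w : Equiv.Perm (Fin n)) (M : Matrix (Fin n) ι ℝ)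
    (i : Fin n) (j : ι) : (permMat w * M) i j = M (w⁻¹ i) j := by
  rw [Matrix.mul_apply, Finset.sum_eq_single (w⁻¹ i)]
  · simp [permMat]
  · intro p _ hp
    have : i ≠ w p := by rintro rfl; simp at hp
    simp [permMat, this]
  · simp

lemma mul_permMat_apply {n : ℕ} {ι : Type*} (w : Equiv.Perm (Fin n)) (M : Matrix ι (Fin n) ℝ)
    (i : ι) (j : Fin n) : (M * permMat w) i j = M i (w j) := by
  rw [Matrix.mul_apply, Finset.sum_eq_single (w j)]
  · simp [permMat]
  · intro p _ hp
    simp [permMat, hp]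
  · simp

lemma permMat_mul_inv {n : ℕ} (u : Equiv.Perm (Fin n)) : permMat u * permMat u⁻¹ = 1 := by
  ext i j
  rw [permMat_mul_apply]
  simp [permMat, Matrix.one_apply]

lemma permMat_inv_mul {n : ℕ} (u : Equiv.Perm (Fin n)) : permMat u⁻¹ * permMat u = 1 := by
  simpa using permMat_mul_inv u⁻¹

lemma permMat_mul_inv_cancel {n : ℕ} (u : Equiv.Perm (Fin n)) (M : Mat n) :
    permMat u * (permMat u⁻¹ * M) = M := by
  rw [← Matrix.mul_assoc, permMat_mul_inv, Matrix.one_mul]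

lemma permMat_inv_mul_cancel {n : ℕ} (u : Equiv.Perm (Fin n)) (M : Mat n) :
    permMat u⁻¹ * (permMat u * M) = M := by
  rw [← Matrix.mul_assoc, permMat_inv_mul, Matrix.one_mul]

/-- The increasing enumeration of `{w⁻¹ 0, …, w⁻¹ (k - 1)}`. -/
def cellCols {n k : ℕ} (w : Equiv.Perm (Fin n)) (hk : k ≤ n) : Fin k → Fin n :=
  (fun a => w⁻¹ (Fin.castLE hk a)) ∘ Tuple.sort fun a => w⁻¹ (Fin.castLE hk a)

lemma strictMono_cellCols {n k : ℕ} (w : Equiv.Perm (Fin n)) (hk : k ≤ n) :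
    StrictMono (cellCols w hk) :=
  strictMono_comp_sort (w⁻¹.injective.comp (Fin.castLE_injective hk))

lemma flag_mul_permMat_inv {n k : ℕ} (u : Equiv.Perm (Fin n)) (x : Mat n) (hk : k ≤ n) :
    flag (x * permMat u⁻¹) hk (Fin.castLE hk) = flag x hk fun a => u⁻¹ (Fin.castLE hk a) := by
  unfold flag
  congr 1
  ext i j
  rw [Matrix.submatrix_apply, mul_permMat_apply, Matrix.submatrix_apply]

lemma flag_cellCols {n k : ℕ} (u : Equiv.Perm (Fin n)) (x : Mat n) (hk : k ≤ n) :
    flag x hk (cellCols u hk) =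
      ((Equiv.Perm.sign (Tuple.sort fun a => u⁻¹ (Fin.castLE hk a)) : ℤ) : ℝ) *
        flag x hk fun a => u⁻¹ (Fin.castLE hk a) := by
  unfold flag
  rw [← Matrix.det_permute', Matrix.submatrix_submatrix]
  rfl

lemma exists_flag_eq {n k : ℕ} {w : Equiv.Perm (Fin n)} {x : Mat n} (hx : x ∈ doubleCosetBm w)
    (hk : k ≤ n) : ∃ c : ℝ, c ≠ 0 ∧ ∃ b : Mat n, lowerTriInv b ∧ ∀ J : Fin k → Fin n,
      flag x hk J = c * (b.submatrix (cellCols w hk) J).det := by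
  obtain ⟨l, b, hl, hb, rfl⟩ := hx
  refine ⟨flag l hk (Fin.castLE hk) *
    ((Equiv.Perm.sign (Tuple.sort fun a => w⁻¹ (Fin.castLE hk a)) : ℤ) : ℝ),
    mul_ne_zero (hl.leading_ne_zero hk) (Int.cast_ne_zero.2 (Units.ne_zero _)), b, hb, fun J => ?_⟩
  rw [Matrix.mul_assoc, flag_lower_mul hk hl, mul_assoc]
  congr 1
  have h1 : b.submatrix (cellCols w hk) J =
      (b.submatrix (fun a => w⁻¹ (Fin.castLE hk a)) J).submatrix
        (Tuple.sort fun a => w⁻¹ (Fin.castLE hk a)) id := rfl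
  rw [h1, Matrix.det_permute, ← mul_assoc, ← Int.cast_mul, ← Units.val_mul, Int.units_mul_self]
  simp only [Units.val_one, Int.cast_one, one_mul]
  unfold flag
  congr 1
  ext i j
  rw [Matrix.submatrix_apply, permMat_mul_apply, Matrix.submatrix_apply]

lemma flag_cellCols_ne_zero {n k : ℕ} {w : Equiv.Perm (Fin n)} {x : Mat n}
    (hx : x ∈ doubleCosetBm w) (hk : k ≤ n) : flag x hk (cellCols w hk) ≠ 0 := by
  obtain ⟨c, hc, b, hb, h⟩ := exists_flag_eq hx hk
  have hb' := lowerTriInv_iff.1 hb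
  rw [h, det_submatrix_blockTriangular negIdx_injective hb'.2
    (strictMono_cellCols w hk).injective]
  exact mul_ne_zero hc (Finset.prod_ne_zero_iff.2 fun i _ =>
    diag_ne_zero negIdx_injective hb'.2 hb.1.ne_zero _)

lemma le_of_perm_le {n k : ℕ} {J M : Fin k → Fin n} (hJ : Monotone J) (hM : Monotone M)
    (σ : Equiv.Perm (Fin k)) (h : ∀ i, J i ≤ M (σ i)) : J ≤ M := by
  intro i
  obtain ⟨j, hj, hji⟩ : ∃ j, i ≤ j ∧ σ j ≤ i := by
    by_contra hcon
    push Not at hcon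
    have h1 : (Finset.Ici i).card ≤ (Finset.Ioi i).card :=
      Finset.card_le_card_of_injOn σ (fun j hj => by
        simpa using hcon j (by simpa using hj)) σ.injective.injOn
    rw [Fin.card_Ici, Fin.card_Ioi] at h1
    have := i.2
    omega
  exact (hJ hj).trans ((h j).trans (hM hji))

lemma le_cellCols {n k : ℕ} {w : Equiv.Perm (Fin n)} {x : Mat n} (hx : x ∈ doubleCosetBm w)
    (hk : k ≤ n) {J : Fin k → Fin n} (hJ : StrictMono J) (h : flag x hk J ≠ 0) :
    J ≤ cellCols w hk := by
  obtain ⟨c, hc, b, hb, hJc⟩ := exists_flag_eq hx hk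
  rw [hJc] at h
  obtain ⟨σ, hσ⟩ := exists_perm_of_det_ne_zero (right_ne_zero_of_mul h)
  refine le_of_perm_le hJ.monotone (strictMono_cellCols w hk).monotone σ fun i => ?_
  by_contra hlt
  exact hσ i (hb.2 _ _ (not_le.1 hlt))

lemma flagNonneg_iff {n : ℕ} {w : Equiv.Perm (Fin n)} {z : Mat n} (hz : z ∈ Ncell w) :
    flagNonneg z ↔ ∀ (k : ℕ) (hk : k ≤ n) (J : Fin k → Fin n), StrictMono J →
      J ≤ cellCols w hk → 0 < flag z hk J := by
  constructor
  · intro h k hk J hJ hle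
    have hc := strictMono_cellCols w hk
    exact flag_pos_of_le hz.1 (h.tnn hz.1) hk hc hJ hle
      (lt_of_le_of_ne (h k hk _ hc) (flag_cellCols_ne_zero hz.2 hk).symm)
  · intro h k hk J hJ
    by_cases h0 : flag z hk J = 0
    · exact h0.ge
    · exact (h k hk J hJ (le_cellCols hz.2 hk hJ h0)).le

lemma continuous_flag {n k : ℕ} {S : Type*} [TopologicalSpace S] {X : S → Mat n}
    (hX : Continuous X) (hk : k ≤ n) (J : Fin k → Fin n) : Continuous fun s => flag (X s) hk J :=
  (hX.matrix_submatrix _ _).matrix_det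

lemma isClosed_flagNonneg {n : ℕ} {S : Type*} [TopologicalSpace S] {X : S → Mat n}
    (hX : Continuous X) : IsClosed {s | flagNonneg (X s)} := by
  simp only [flagNonneg, Set.ofPred_forall]
  exact isClosed_iInter fun k => isClosed_iInter fun hk => isClosed_iInter fun J =>
    isClosed_iInter fun _ => isClosed_le continuous_const (continuous_flag hX hk J)

/-- Total nonnegativity is preserved along paths inside a cell. -/
lemma flagNonneg_of_path {n : ℕ} {w : Equiv.Perm (Fin n)} {S : Type*} [TopologicalSpace S]
    [PreconnectedSpace S] {z : S → Mat n} (hz : Continuous z) (hw : ∀ s, z s ∈ Ncell w)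
    (s₀ : S) (h₀ : flagNonneg (z s₀)) (s : S) : flagNonneg (z s) := by
  have hopen : IsOpen {s | flagNonneg (z s)} := by
    have e : {s | flagNonneg (z s)} = ⋂ p : Σ k : Fin (n + 1), (Fin (k : ℕ) → Fin n),
        {s | StrictMono p.2 → p.2 ≤ cellCols w (Nat.le_of_lt_succ p.1.2) →
          0 < flag (z s) (Nat.le_of_lt_succ p.1.2) p.2} := by
      ext s
      simp only [Set.mem_ofPred_eq, Set.mem_iInter, flagNonneg_iff (hw s)]
      exact ⟨fun h p => h _ _ _, fun h k hk J => h ⟨⟨k, Nat.lt_succ_of_le hk⟩, J⟩⟩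
    rw [e]
    refine isOpen_iInter_of_finite fun p => ?_
    by_cases h : StrictMono p.2 ∧ p.2 ≤ cellCols w (Nat.le_of_lt_succ p.1.2)
    · simp only [h.1, h.2, true_imp_iff]
      exact isOpen_lt continuous_const (continuous_flag hz _ _)
    · convert isOpen_univ using 1
      ext s
      simp only [Set.mem_ofPred_eq, Set.mem_univ, iff_true]
      exact fun h1 h2 => absurd ⟨h1, h2⟩ h
  have h1 := IsClopen.eq_univ ⟨isClosed_flagNonneg hz, hopen⟩ ⟨s₀, h₀⟩
  exact (h1 ▸ Set.mem_univ s : s ∈ {s | flagNonneg (z s)})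

lemma card_filter_lt_inv {n k : ℕ} (u : Equiv.Perm (Fin n)) (hk : k ≤ n) (i : Fin n) :
    (Finset.univ.filter fun a : Fin k => i < u⁻¹ (Fin.castLE hk a)).card +
      (Finset.univ.filter fun m : Fin n => m ≤ i).card = k +
      (Finset.univ.filter fun m : Fin n => m ≤ i ∧ k ≤ (u m : ℕ)).card := by
  have h1 := Finset.card_filter_add_card_filter_not (s := (Finset.univ : Finset (Fin k)))
    (fun a => i < u⁻¹ (Fin.castLE hk a))
  rw [Finset.card_univ, Fintype.card_fin] at h1
  have h2 := Finset.card_filter_add_card_filter_not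
    (s := Finset.univ.filter fun m : Fin n => m ≤ i) (fun m => k ≤ (u m : ℕ))
  rw [Finset.filter_filter, Finset.filter_filter] at h2
  have h3 : (Finset.univ.filter fun a : Fin k => ¬ i < u⁻¹ (Fin.castLE hk a)).card =
      (Finset.univ.filter fun m : Fin n => m ≤ i ∧ ¬ k ≤ (u m : ℕ)).card := by
    refine Finset.card_bij (fun a _ => u⁻¹ (Fin.castLE hk a)) ?_ ?_ ?_
    · intro a ha
      simp only [Finset.mem_filter, Finset.mem_univ, true_and, not_lt] at ha ⊢
      refine ⟨ha, ?_⟩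
      simp
    · intro a _ b _ hab
      exact Fin.castLE_injective hk (u⁻¹.injective hab)
    · intro m hm
      simp only [Finset.mem_filter, Finset.mem_univ, true_and, not_le] at hm
      refine ⟨⟨u m, hm.2⟩, ?_, ?_⟩
      · simp only [Finset.mem_filter, Finset.mem_univ, true_and, not_lt]
        have : u⁻¹ (Fin.castLE hk ⟨u m, hm.2⟩) = m := u.symm_apply_apply m
        rw [this]; exact hm.1
      · exact u.symm_apply_apply m
  omega

lemma bruhatLE.card_le {n k : ℕ} {u v : Equiv.Perm (Fin n)} (h : bruhatLE u v) (hk : k ≤ n)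
    (i : Fin n) : (Finset.univ.filter fun a : Fin k => i < u⁻¹ (Fin.castLE hk a)).card ≤
      (Finset.univ.filter fun a : Fin k => i < v⁻¹ (Fin.castLE hk a)).card := by
  have h1 := card_filter_lt_inv u hk i
  have h2 := card_filter_lt_inv v hk i
  have h3 : (Finset.univ.filter fun m : Fin n => m ≤ i ∧ k ≤ (u m : ℕ)).card ≤
      (Finset.univ.filter fun m : Fin n => m ≤ i ∧ k ≤ (v m : ℕ)).card := by
    rcases hk.eq_or_lt with rfl | hlt
    · rw [Finset.card_eq_zero.2]
      · exact Nat.zero_le _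
      · refine Finset.filter_eq_empty_iff.2 fun m _ hm => ?_
        have := (u m).2
        omega
    · exact h i ⟨k, hlt⟩
  omega

lemma card_filter_cellCols {n k : ℕ} (u : Equiv.Perm (Fin n)) (hk : k ≤ n) (i : Fin n) :
    (Finset.univ.filter fun a : Fin k => i < cellCols u hk a).card =
      (Finset.univ.filter fun a : Fin k => i < u⁻¹ (Fin.castLE hk a)).card := by
  refine Finset.card_bij
    (fun a _ => Tuple.sort (fun a : Fin k => u⁻¹ (Fin.castLE hk a)) a) ?_ ?_ ?_
  · intro a ha
    simp only [Finset.mem_filter, Finset.mem_univ, true_and] at ha ⊢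
    exact ha
  · intro a _ b _ hab
    exact Equiv.injective _ hab
  · intro b hb
    refine ⟨(Tuple.sort fun a : Fin k => u⁻¹ (Fin.castLE hk a)).symm b, ?_, ?_⟩
    · simp only [Finset.mem_filter, Finset.mem_univ, true_and] at hb ⊢
      simpa only [cellCols, Function.comp_apply, Equiv.apply_symm_apply] using hb
    · simp

lemma bruhatLE.cellCols_le {n k : ℕ} {u v : Equiv.Perm (Fin n)} (h : bruhatLE u v) (hk : k ≤ n) :
    cellCols u hk ≤ cellCols v hk := by
  intro a
  by_contra hlt
  rw [not_le] at hlt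
  have h1 := h.card_le hk (cellCols v hk a)
  rw [← card_filter_cellCols, ← card_filter_cellCols] at h1
  have h2 : (Finset.Ici a).card ≤
      (Finset.univ.filter fun b : Fin k => cellCols v hk a < cellCols u hk b).card := by
    refine Finset.card_le_card fun b hb => ?_
    rw [Finset.mem_Ici] at hb
    simp only [Finset.mem_filter, Finset.mem_univ, true_and]
    exact hlt.trans_le ((strictMono_cellCols u hk).monotone hb)
  have h3 : (Finset.univ.filter fun b : Fin k => cellCols v hk a < cellCols v hk b).card ≤
      (Finset.Ioi a).card := by
    refine Finset.card_le_card fun b hb => ?_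
    simp only [Finset.mem_filter, Finset.mem_univ, true_and] at hb
    rw [Finset.mem_Ioi]
    exact (strictMono_cellCols v hk).lt_iff_lt.1 hb
  rw [Fin.card_Ici] at h2
  rw [Fin.card_Ioi] at h3
  have := a.2
  omega

lemma Ycirc_iff {n : ℕ} {w : Equiv.Perm (Fin n)} {x : Mat n} :
    x ∈ Ycirc w ↔ x ∈ Ncell w ∧ flagNonneg x := by
  constructor
  · rintro ⟨h1, h2, h3⟩
    exact ⟨⟨h1, h3⟩, (totNonneg_iff.1 h2).flagNonneg⟩
  · rintro ⟨⟨h1, h3⟩, h2⟩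
    exact ⟨h1, totNonneg_iff.2 (h2.tnn h1), h3⟩

lemma hasGauss_mul_permMat_inv {n : ℕ} {u v : Equiv.Perm (Fin n)} {x : Mat n} (huv : bruhatLE u v)
    (hx : x ∈ Ycirc v) : hasGauss (x * permMat u⁻¹) := by
  rw [Ycirc_iff] at hx
  refine hasGauss_of_leading fun k hk => ?_
  rw [flag_mul_permMat_inv]
  have h1 := (flagNonneg_iff hx.1).1 hx.2 k hk _ (strictMono_cellCols u hk) (huv.cellCols_le hk)
  rw [flag_cellCols] at h1
  exact right_ne_zero_of_mul h1.ne'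

lemma conj_permMat_apply {n : ℕ} (u : Equiv.Perm (Fin n)) (y : Mat n) (i j : Fin n) :
    (permMat u⁻¹ * y * permMat u) i j = y (u i) (u j) := by
  rw [mul_permMat_apply, permMat_mul_apply, inv_inv]

lemma exists_conj_iff {n : ℕ} {u : Equiv.Perm (Fin n)} {x : Mat n} :
    (∃ y : Mat n, upperUni y ∧ x = permMat u⁻¹ * y * permMat u) ↔ UniFor (permIdx u) x := by
  constructor
  · rintro ⟨y, hy, rfl⟩
    refine ⟨fun i => ?_, fun i j hij => ?_⟩
    · rw [conj_permMat_apply, hy.1]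
    · rw [conj_permMat_apply]
      refine hy.2 _ _ ?_
      simp only [permIdx] at hij
      rw [Fin.lt_def]
      omega
  · intro hx
    refine ⟨x.submatrix u.symm u.symm, ⟨fun i => hx.1 _, fun i j hij => hx.2 ?_⟩, ?_⟩
    · simp only [permIdx, Equiv.apply_symm_apply]
      rw [Fin.lt_def] at hij
      omega
    · ext i j
      rw [conj_permMat_apply]
      simp

lemma mem_Nminus_iff {n : ℕ} {u : Equiv.Perm (Fin n)} {x : Mat n} :
    x ∈ Nminus u ↔ lowerUni x ∧ UniFor (permIdx u) x :=
  and_congr_right fun _ => exists_conj_iff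

lemma mem_Ngrp_iff {n : ℕ} {u : Equiv.Perm (Fin n)} {x : Mat n} :
    x ∈ Ngrp u ↔ upperUni x ∧ UniFor (permIdx u) x :=
  and_congr_right fun _ => exists_conj_iff

lemma UniFor.upperUni_conj {n : ℕ} {u : Equiv.Perm (Fin n)} {x : Mat n}
    (hx : UniFor (permIdx u) x) : upperUni (permMat u * x * permMat u⁻¹) := by
  obtain ⟨y, hy, rfl⟩ := exists_conj_iff.2 hx
  simp only [Matrix.mul_assoc, permMat_mul_inv_cancel, permMat_mul_inv, Matrix.mul_one]
  exact hy

lemma Amat_spec {n : ℕ} {u : Equiv.Perm (Fin n)} {x : Mat n}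
    (hg : hasGauss (x * permMat u⁻¹)) : UniFor (permIdx u) (Amat u x) ∧
      ∃ l, lowerTriInv l ∧ x = l * permMat u * Amat u x := by
  obtain ⟨hb, l, hl, hx⟩ := gaussPlus_spec hg
  refine ⟨exists_conj_iff.1 ⟨_, hb, rfl⟩, l, hl, ?_⟩
  unfold Amat
  simp only [Matrix.mul_assoc, permMat_mul_inv_cancel]
  rw [← Matrix.mul_assoc, ← hx, Matrix.mul_assoc, permMat_inv_mul, Matrix.mul_one]

lemma Amat_eq {n : ℕ} {u : Equiv.Perm (Fin n)} {l A : Mat n} (hl : lowerTriInv l)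
    (hA : UniFor (permIdx u) A) : hasGauss (l * permMat u * A * permMat u⁻¹) ∧
      Amat u (l * permMat u * A) = A := by
  have e : l * permMat u * A * permMat u⁻¹ = l * (permMat u * A * permMat u⁻¹) := by
    simp only [Matrix.mul_assoc]
  refine ⟨?_, ?_⟩
  · rw [e]; exact hasGauss_mul hl hA.upperUni_conj
  · unfold Amat
    rw [e, gaussPlus_mul hl hA.upperUni_conj]
    simp only [Matrix.mul_assoc, permMat_inv_mul_cancel, permMat_inv_mul, Matrix.mul_one]

/-- On the cell of `u` the matrix `Amat u y` lies in `N_-(u)`. -/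
lemma Amat_of_mem_doubleCosetBm {n : ℕ} {u : Equiv.Perm (Fin n)} {y : Mat n}
    (hy : y ∈ doubleCosetBm u) : hasGauss (y * permMat u⁻¹) ∧ lowerUni (Amat u y) := by
  obtain ⟨c, b, hc, hb, rfl⟩ := hy
  set g := permMat u * b * permMat u⁻¹ with hg
  have hg_apply : ∀ i j, g i j = b (u⁻¹ i) (u⁻¹ j) := fun i j => by
    rw [hg, mul_permMat_apply, permMat_mul_apply]
  let v : Fin n → ℤ := fun i => - permIdx u⁻¹ i
  have hv : Function.Injective v := fun i j h => permIdx_injective u⁻¹ (neg_injective h)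
  have hgv : g.BlockTriangular v := by
    intro i j hij
    rw [hg_apply]
    refine hb.2 _ _ ?_
    simp only [v, permIdx] at hij
    rw [Fin.lt_def]
    omega
  have hd : g.det ≠ 0 := by
    have h1 : IsUnit (permMat u).det := by
      have := congrArg Matrix.det (permMat_mul_inv u)
      rw [Matrix.det_mul, Matrix.det_one] at this
      exact IsUnit.of_mul_eq_one _ this
    have h2 : IsUnit (permMat u⁻¹).det := by
      have := congrArg Matrix.det (permMat_inv_mul u)
      rw [Matrix.det_mul, Matrix.det_one] at this
      exact IsUnit.of_mul_eq_one _ this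
    rw [hg, Matrix.det_mul, Matrix.det_mul]
    exact ((h1.mul hb.1).mul h2).ne_zero
  have hG := hasGauss_of_blockTriangular hv hgv hd
  have e : c * permMat u * b * permMat u⁻¹ = c * g := by
    rw [hg]; simp only [Matrix.mul_assoc]
  refine ⟨e ▸ hasGauss_lower_mul hc hG, ?_⟩
  unfold Amat
  rw [e, gaussPlus_lower_mul hc hG]
  refine ⟨fun i => ?_, fun i j hij => ?_⟩
  · rw [conj_permMat_apply, (gaussPlus_spec hG).1.1]
  · rw [conj_permMat_apply]
    refine gaussPlus_blockTriangular hv hgv hd ?_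
    have hi : u⁻¹ (u i) = i := u.symm_apply_apply i
    have hj : u⁻¹ (u j) = j := u.symm_apply_apply j
    simp only [v, permIdx, hi, hj]
    rw [Fin.lt_def] at hij
    omega

lemma mul_mem_doubleCosetBm {n : ℕ} {w : Equiv.Perm (Fin n)} {l x b : Mat n} (hl : lowerTriInv l)
    (hx : x ∈ doubleCosetBm w) (hb : lowerTriInv b) : l * x * b ∈ doubleCosetBm w := by
  obtain ⟨c, d, hc, hd, rfl⟩ := hx
  exact ⟨l * c, d * b, hl.mul hc, hd.mul hb, by simp only [Matrix.mul_assoc]⟩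

lemma gaussPlus_mem_Ncell {n : ℕ} {w : Equiv.Perm (Fin n)} {x b : Mat n}
    (hx : x ∈ doubleCosetBm w) (hb : lowerTriInv b) (hg : hasGauss (x * b)) :
    gaussPlus (x * b) ∈ Ncell w := by
  obtain ⟨h1, l, hl, h2⟩ := gaussPlus_spec hg
  refine ⟨h1, ?_⟩
  have e : gaussPlus (x * b) = l⁻¹ * x * b := by
    rw [Matrix.mul_assoc, h2, gaussPlus_mul hl h1, ← Matrix.mul_assoc,
      Matrix.nonsing_inv_mul _ hl.1, Matrix.one_mul]
  rw [e]
  exact mul_mem_doubleCosetBm hl.inv hx hb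

lemma piMap_mul {n : ℕ} {u : Equiv.Perm (Fin n)} {y b : Mat n} (hy : y ∈ Ncell u)
    (hb : upperUni b) (hbu : UniFor (permIdx u) b) : hasGauss (y * b * permMat u⁻¹) ∧
      Amat u (y * b) = Amat u y * b ∧ piMap u (y * b) = y := by
  obtain ⟨hg, hq⟩ := Amat_of_mem_doubleCosetBm hy.2
  obtain ⟨hqu, l, hl, hyl⟩ := Amat_spec hg
  have e : y * b = l * permMat u * (Amat u y * b) := by
    conv_lhs => rw [hyl]
    simp only [Matrix.mul_assoc]
  obtain ⟨h1, h2⟩ := Amat_eq hl (hqu.mul (permIdx_injective u) hbu)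
  rw [← e] at h1 h2
  refine ⟨h1, h2, ?_⟩
  unfold piMap
  rw [h2, gaussMinus_mul hq hb]
  have e2 : permMat u * Amat u y = l⁻¹ * y := by
    conv_rhs => rw [hyl, Matrix.mul_assoc, ← Matrix.mul_assoc, Matrix.nonsing_inv_mul _ hl.1,
      Matrix.one_mul]
  rw [e2, gaussPlus_mul hl.inv hy.1]

lemma piMap_spec {n : ℕ} {u : Equiv.Perm (Fin n)} {x : Mat n} (hx : upperUni x)
    (hg : hasGauss (x * permMat u⁻¹)) : ∃ b, upperUni b ∧ UniFor (permIdx u) b ∧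
      piMap u x ∈ Ncell u ∧ x = piMap u x * b := by
  obtain ⟨hA, l, hl, hxl⟩ := Amat_spec hg
  obtain ⟨hG, hbu, a, ha, hau, hab⟩ := hA.gauss (permIdx_injective u)
  have hb := (gaussPlus_spec hG).1
  refine ⟨gaussPlus (Amat u x), hb, hbu, ?_⟩
  have h1 : l * permMat u * a = x * (gaussPlus (Amat u x))⁻¹ := by
    have h0 : a = Amat u x * (gaussPlus (Amat u x))⁻¹ := by
      conv_rhs => enter [1]; rw [hab]
      rw [Matrix.mul_assoc, Matrix.mul_nonsing_inv _ hb.isUnit, Matrix.mul_one]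
    conv_rhs => enter [1]; rw [hxl]
    rw [Matrix.mul_assoc _ (Amat u x), ← h0]
  have h2 : l * permMat u * a ∈ Ncell u :=
    ⟨h1 ▸ hx.mul hb.inv, l, a, hl, ha.triInv, rfl⟩
  have h3 : x = l * permMat u * a * gaussPlus (Amat u x) := by
    rw [h1, Matrix.mul_assoc, Matrix.nonsing_inv_mul _ hb.isUnit, Matrix.mul_one]
  have h4 := (piMap_mul h2 hb hbu).2.2
  rw [← h3] at h4
  rw [h4]
  exact ⟨h2, h3⟩

/-- An explicit formula for the projection `ρ_y`. -/
noncomputable def rhoFormula {n : ℕ} (u : Equiv.Perm (Fin n)) (y x : Mat n) : Mat n :=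
  y * (gaussPlus ((Amat u x)⁻¹ * Amat u y))⁻¹

lemma rhoFormula_factor {n : ℕ} {u : Equiv.Perm (Fin n)} {x y : Mat n}
    (hg : hasGauss (x * permMat u⁻¹)) (hy : y ∈ Ncell u) :
    hasGauss ((Amat u x)⁻¹ * Amat u y) ∧ ∃ nm m, nm ∈ Nminus u ∧ m ∈ Ngrp u ∧
      m = (gaussPlus ((Amat u x)⁻¹ * Amat u y))⁻¹ ∧
      Amat u x * nm = Amat u y * m ∧ hasGauss (x * nm) ∧ gaussPlus (x * nm) = y * m := by
  have hu := permIdx_injective u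
  obtain ⟨hA, l, hl, hxl⟩ := Amat_spec hg
  obtain ⟨hgy, hq⟩ := Amat_of_mem_doubleCosetBm hy.2
  obtain ⟨hqu, ly, hly, hyl⟩ := Amat_spec hgy
  obtain ⟨hG, hgu, a, ha, hau, hab⟩ := ((hA.inv hu).mul hu hqu).gauss hu
  have hgU := (gaussPlus_spec hG).1
  set g := gaussPlus ((Amat u x)⁻¹ * Amat u y) with hgdef
  have e1 : Amat u x * a = Amat u y * g⁻¹ := by
    have : a = (Amat u x)⁻¹ * Amat u y * g⁻¹ := by
      rw [hab, Matrix.mul_assoc, Matrix.mul_nonsing_inv _ hgU.isUnit, Matrix.mul_one]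
    rw [this, ← Matrix.mul_assoc, ← Matrix.mul_assoc, Matrix.mul_nonsing_inv _ (hA.isUnit hu),
      Matrix.one_mul]
  have e2 : x * a = l * ly⁻¹ * (y * g⁻¹) := by
    have h1 : permMat u * Amat u y = ly⁻¹ * y := by
      conv_rhs => rw [hyl, Matrix.mul_assoc, ← Matrix.mul_assoc, Matrix.nonsing_inv_mul _ hly.1,
        Matrix.one_mul]
    calc x * a = l * permMat u * (Amat u x * a) := by
          conv_lhs => rw [hxl]
          simp only [Matrix.mul_assoc]
      _ = l * (permMat u * Amat u y) * g⁻¹ := by rw [e1]; simp only [Matrix.mul_assoc]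
      _ = _ := by rw [h1]; simp only [Matrix.mul_assoc]
  refine ⟨hG, a, g⁻¹, mem_Nminus_iff.2 ⟨ha, hau⟩, mem_Ngrp_iff.2 ⟨hgU.inv, hgu.inv hu⟩, rfl, e1,
    ?_, ?_⟩
  · rw [e2]; exact hasGauss_mul (hl.mul hly.inv) (hy.1.mul hgU.inv)
  · rw [e2]; exact gaussPlus_mul (hl.mul hly.inv) (hy.1.mul hgU.inv)

lemma rho_spec {n : ℕ} {u : Equiv.Perm (Fin n)} {x y : Mat n}
    (hg : hasGauss (x * permMat u⁻¹)) (hy : y ∈ Ncell u) :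
    rho u y x = rhoFormula u y x ∧
      ∃ nm ∈ Nminus u, hasGauss (x * nm) ∧ rho u y x = gaussPlus (x * nm) := by
  have hu := permIdx_injective u
  obtain ⟨hG, nm, m, hnm, hm, hmg, e1, hG2, e2⟩ := rhoFormula_factor hg hy
  have hex : ∃ nm ∈ Nminus u, hasGauss (x * nm) ∧ ∃ m ∈ Ngrp u, gaussPlus (x * nm) = y * m :=
    ⟨nm, hnm, hG2, m, hm, e2⟩
  have huniq : hex.choose = nm := by
    obtain ⟨hnm', hG', m', hm', e'⟩ := hex.choose_spec
    set nm' := hex.choose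
    obtain ⟨-, l', hl', hx'⟩ := gaussPlus_spec hG'
    obtain ⟨hA, l, hl, hxl⟩ := Amat_spec hg
    obtain ⟨hgy, hq⟩ := Amat_of_mem_doubleCosetBm hy.2
    obtain ⟨hqu, ly, hly, hyl⟩ := Amat_spec hgy
    rw [mem_Nminus_iff] at hnm hnm'
    rw [mem_Ngrp_iff] at hm hm'
    have h1 : x * nm' = l * permMat u * (Amat u x * nm') := by
      conv_lhs => rw [hxl]
      simp only [Matrix.mul_assoc]
    have h2 : x * nm' = l' * ly * permMat u * (Amat u y * m') := by
      rw [hx', e']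
      conv_lhs => enter [2, 1]; rw [hyl]
      simp only [Matrix.mul_assoc]
    have h3 : Amat u x * nm' = Amat u y * m' := by
      rw [← (Amat_eq hl (hA.mul hu hnm'.2)).2, ← h1, h2,
        (Amat_eq (hl'.mul hly) (hqu.mul hu hm'.2)).2]
    have key : ∀ {p q : Mat n}, upperUni q → Amat u x * p = Amat u y * q →
        p * q⁻¹ = (Amat u x)⁻¹ * Amat u y := fun {p q} hq h => by
      have : p = (Amat u x)⁻¹ * (Amat u y * q) := by
        rw [← h, ← Matrix.mul_assoc, Matrix.nonsing_inv_mul _ (hA.isUnit hu), Matrix.one_mul]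
      rw [this, Matrix.mul_assoc, Matrix.mul_assoc, Matrix.mul_nonsing_inv _ hq.isUnit,
        Matrix.mul_one]
    exact (lowerTri_mul_unique hnm'.1.triInv hnm.1.triInv hm'.1.inv hm.1.inv
      ((key hm'.1 h3).trans (key hm.1 e1).symm)).1
  refine ⟨?_, nm, hnm, hG2, ?_⟩
  · unfold rho rhoFormula
    rw [dif_pos hex, huniq, e2, hmg]
  · unfold rho
    rw [dif_pos hex, huniq]

lemma rhoFormula_mul_of_Amat {n : ℕ} {u : Equiv.Perm (Fin n)} {x y b nm : Mat n}
    (hA : UniFor (permIdx u) (Amat u y)) (hnm : lowerUni nm) (hb : upperUni b)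
    (h : Amat u x = Amat u y * b * nm) : rhoFormula u y x = y * b := by
  have hu := permIdx_injective u
  unfold rhoFormula
  have e : (Amat u x)⁻¹ * Amat u y = nm⁻¹ * b⁻¹ := by
    rw [h, Matrix.mul_inv_rev, Matrix.mul_inv_rev, Matrix.mul_assoc, Matrix.mul_assoc,
      Matrix.nonsing_inv_mul _ (hA.isUnit hu), Matrix.mul_one]
  rw [e, gaussPlus_mul hnm.inv.triInv hb.inv, Matrix.nonsing_inv_nonsing_inv _ hb.isUnit]

/-- The projection `ρ` onto the fiber of `π_u(x)` fixes `x`. -/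
lemma rhoFormula_piMap {n : ℕ} {u : Equiv.Perm (Fin n)} {x : Mat n} (hx : upperUni x)
    (hg : hasGauss (x * permMat u⁻¹)) : rhoFormula u (piMap u x) x = x := by
  obtain ⟨b, hb, hbu, hy, hxb⟩ := piMap_spec hx hg
  obtain ⟨h1, h2, h3⟩ := piMap_mul hy hb hbu
  rw [← hxb] at h2
  have hA := (Amat_spec (Amat_of_mem_doubleCosetBm hy.2).1).1
  rw [rhoFormula_mul_of_Amat hA lowerUni_one hb (by rw [h2, Matrix.mul_one]), ← hxb]

lemma rhoFormula_mem_Ncell {n : ℕ} {u w : Equiv.Perm (Fin n)} {x y : Mat n}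
    (hg : hasGauss (x * permMat u⁻¹)) (hy : y ∈ Ncell u) (hx : x ∈ doubleCosetBm w) :
    rhoFormula u y x ∈ Ncell w := by
  obtain ⟨hG, nm, m, hnm, hm, hmg, e1, hG2, e2⟩ := rhoFormula_factor hg hy
  have : rhoFormula u y x = gaussPlus (x * nm) := by
    rw [e2, hmg, rhoFormula]
  rw [this]
  exact gaussPlus_mem_Ncell hx hnm.1.triInv hG2

lemma piMap_rhoFormula {n : ℕ} {u : Equiv.Perm (Fin n)} {x y : Mat n}
    (hg : hasGauss (x * permMat u⁻¹)) (hy : y ∈ Ncell u) :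
    hasGauss (rhoFormula u y x * permMat u⁻¹) ∧ piMap u (rhoFormula u y x) = y := by
  obtain ⟨hG, nm, m, hnm, hm, hmg, e1, hG2, e2⟩ := rhoFormula_factor hg hy
  have : rhoFormula u y x = y * m := by rw [hmg, rhoFormula]
  rw [this]
  rw [mem_Ngrp_iff] at hm
  obtain ⟨h1, h2, h3⟩ := piMap_mul hy hm.1 hm.2
  exact ⟨h1, h3⟩

lemma rhoFormula_rhoFormula {n : ℕ} {u : Equiv.Perm (Fin n)} {x y : Mat n} (hx : upperUni x)
    (hg : hasGauss (x * permMat u⁻¹)) (hy : y ∈ Ncell u) :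
    rhoFormula u (piMap u x) (rhoFormula u y x) = x := by
  obtain ⟨hG, nm, m, hnm, hm, hmg, e1, hG2, e2⟩ := rhoFormula_factor hg hy
  have hr : rhoFormula u y x = y * m := by rw [hmg, rhoFormula]
  rw [mem_Ngrp_iff] at hm
  obtain ⟨b, hb, hbu, hy', hxb⟩ := piMap_spec hx hg
  have hA := (Amat_spec (Amat_of_mem_doubleCosetBm hy'.2).1).1
  have h2 := (piMap_mul hy' hb hbu).2.1
  rw [← hxb] at h2
  rw [rhoFormula_mul_of_Amat hA hnm.1 hb, ← hxb]
  rw [hr, (piMap_mul hy hm.1 hm.2).2.1, ← e1, h2]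

/-- The scaling of the subdiagonals of a lower triangular matrix, the `r`-th one by `s ^ r`. -/
def lowerScale {n : ℕ} (s : ℝ) (M : Mat n) : Mat n :=
  Matrix.of fun i j => s ^ ((i : ℕ) - (j : ℕ)) * M i j

/-- The scaling of the superdiagonals of an upper triangular matrix, the `r`-th one by `s ^ r`. -/
def upperScale {n : ℕ} (s : ℝ) (M : Mat n) : Mat n :=
  Matrix.of fun i j => s ^ ((j : ℕ) - (i : ℕ)) * M i j

lemma UniFor.lowerScale {n : ℕ} {v : Fin n → ℤ} {M : Mat n} (hM : UniFor v M) (s : ℝ) :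
    UniFor v (lowerScale s M) :=
  ⟨fun i => by simp [BruhatTNN.lowerScale, hM.1],
    fun i j hij => by
      change _ * M i j = 0
      rw [hM.2 hij, mul_zero]⟩

lemma UniFor.upperScale {n : ℕ} {v : Fin n → ℤ} {M : Mat n} (hM : UniFor v M) (s : ℝ) :
    UniFor v (upperScale s M) :=
  ⟨fun i => by simp [BruhatTNN.upperScale, hM.1],
    fun i j hij => by
      change _ * M i j = 0
      rw [hM.2 hij, mul_zero]⟩

lemma lowerUni.lowerScale {n : ℕ} {M : Mat n} (hM : lowerUni M) (s : ℝ) :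
    lowerUni (lowerScale s M) :=
  lowerUni_iff.2 ((lowerUni_iff.1 hM).lowerScale s)

lemma upperUni.upperScale {n : ℕ} {M : Mat n} (hM : upperUni M) (s : ℝ) :
    upperUni (upperScale s M) :=
  upperUni_iff.2 ((upperUni_iff.1 hM).upperScale s)

lemma lowerScale_mul {n : ℕ} {M N : Mat n} (hM : lowerUni M) (hN : lowerUni N) (s : ℝ) :
    lowerScale s (M * N) = lowerScale s M * lowerScale s N := by
  ext i j
  simp only [lowerScale, Matrix.of_apply, Matrix.mul_apply, Finset.mul_sum]
  refine Finset.sum_congr rfl fun k _ => ?_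
  by_cases h1 : i < k
  · rw [hM.2 i k h1]; ring
  by_cases h2 : k < j
  · rw [hN.2 k j h2]; ring
  rw [Fin.lt_def] at h1 h2
  have : (i : ℕ) - (j : ℕ) = ((i : ℕ) - (k : ℕ)) + ((k : ℕ) - (j : ℕ)) := by omega
  rw [this, pow_add]; ring

lemma lowerScale_lowerScale {n : ℕ} (s t : ℝ) (M : Mat n) :
    lowerScale s (lowerScale t M) = lowerScale (s * t) M := by
  ext i j
  simp only [lowerScale, Matrix.of_apply, mul_pow]
  ring

lemma lowerScale_one_left {n : ℕ} (M : Mat n) : lowerScale 1 M = M := by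
  ext i j; simp [lowerScale]

lemma upperScale_one_left {n : ℕ} (M : Mat n) : upperScale 1 M = M := by
  ext i j; simp [upperScale]

lemma lowerScale_zero_left {n : ℕ} {M : Mat n} (hM : lowerUni M) : lowerScale 0 M = 1 := by
  ext i j
  simp only [lowerScale, Matrix.of_apply]
  rcases lt_trichotomy i j with h | h | h
  · rw [hM.2 i j h, mul_zero, Matrix.one_apply_ne h.ne]
  · subst h; simp [hM.1]
  · have h' := Fin.lt_def.1 h
    rw [zero_pow (by omega), zero_mul, Matrix.one_apply_ne h.ne']

lemma upperScale_zero_left {n : ℕ} {M : Mat n} (hM : upperUni M) : upperScale 0 M = 1 := by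
  ext i j
  simp only [upperScale, Matrix.of_apply]
  rcases lt_trichotomy i j with h | h | h
  · have h' := Fin.lt_def.1 h
    rw [zero_pow (by omega), zero_mul, Matrix.one_apply_ne h.ne]
  · subst h; simp [hM.1]
  · rw [hM.2 i j h, mul_zero, Matrix.one_apply_ne h.ne']

lemma lowerScale_mul_diagonal {n : ℕ} {M : Mat n} (hM : lowerUni M) (s : ℝ) :
    lowerScale s M * Matrix.diagonal (fun i : Fin n => s ^ (i : ℕ)) =
      Matrix.diagonal (fun i : Fin n => s ^ (i : ℕ)) * M := by
  ext i j
  rw [Matrix.mul_diagonal, Matrix.diagonal_mul]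
  simp only [lowerScale, Matrix.of_apply]
  by_cases h : i < j
  · rw [hM.2 i j h]; ring
  · rw [Fin.lt_def] at h
    have : (i : ℕ) = ((i : ℕ) - (j : ℕ)) + (j : ℕ) := by omega
    conv_rhs => rw [this, pow_add]
    ring

lemma diagonal_mul_upperScale {n : ℕ} {M : Mat n} (hM : upperUni M) (s : ℝ) :
    Matrix.diagonal (fun i : Fin n => s ^ (i : ℕ)) * upperScale s M =
      M * Matrix.diagonal (fun i : Fin n => s ^ (i : ℕ)) := by
  ext i j
  rw [Matrix.mul_diagonal, Matrix.diagonal_mul]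
  simp only [upperScale, Matrix.of_apply]
  by_cases h : j < i
  · rw [hM.2 i j h]; ring
  · rw [Fin.lt_def] at h
    have : (j : ℕ) = (i : ℕ) + ((j : ℕ) - (i : ℕ)) := by omega
    conv_rhs => rw [this, pow_add]
    ring

lemma continuous_lowerScale {n : ℕ} (M : Mat n) : Continuous fun s => lowerScale s M :=
  continuous_matrix fun i j => by simp only [lowerScale, Matrix.of_apply]; fun_prop

lemma continuous_upperScale {n : ℕ} {S : Type*} [TopologicalSpace S] {f : S → ℝ} {M : S → Mat n}
    (hf : Continuous f) (hM : Continuous M) : Continuous fun s => upperScale (f s) (M s) :=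
  continuous_matrix fun i j => by
    simp only [upperScale, Matrix.of_apply]
    exact (hf.pow _).mul (hM.matrix_elem i j)

lemma continuous_inv_of_upperUni {n : ℕ} {S : Type*} [TopologicalSpace S] {M : S → Mat n}
    (hM : Continuous M) (hu : ∀ s, upperUni (M s)) : Continuous fun s => (M s)⁻¹ := by
  have e : (fun s => (M s)⁻¹) = fun s => (M s).adjugate := by
    funext s
    rw [Matrix.inv_def, (upperUni_iff.1 (hu s)).det idx_injective, Ring.inverse_one, one_smul]
  rw [e]
  exact hM.matrix_adjugate

lemma zero_mem_of_isClosed {C : Set ℝ} (hC : IsClosed C) (h : Set.Ioi 0 ⊆ C) : (0 : ℝ) ∈ C := by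
  have := closure_minimal h hC
  rw [closure_Ioi] at this
  exact this (Set.mem_Ici.2 le_rfl)

lemma lowerTriInv_diagonal_pow {n : ℕ} {s : ℝ} (hs : s ≠ 0) :
    lowerTriInv (Matrix.diagonal (fun i : Fin n => s ^ (i : ℕ)) : Mat n) := by
  refine ⟨?_, fun i j h => Matrix.diagonal_apply_ne _ h.ne⟩
  rw [Matrix.det_diagonal]
  exact (Finset.prod_ne_zero_iff.2 fun i _ => pow_ne_zero _ hs).isUnit

/-- The projection `π_u` preserves total nonnegativity. -/
lemma flagNonneg_piMap {n : ℕ} {u w : Equiv.Perm (Fin n)} {x : Mat n} (huw : bruhatLE u w)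
    (hx : x ∈ Ycirc w) : flagNonneg (piMap u x) := by
  have hu := permIdx_injective u
  have hg := hasGauss_mul_permMat_inv huw hx
  obtain ⟨hxw, hxf⟩ := Ycirc_iff.1 hx
  obtain ⟨b, hb, hbu, hy, hxb⟩ := piMap_spec hx.1 hg
  set y := piMap u x with hydef
  obtain ⟨hgy, ha⟩ := Amat_of_mem_doubleCosetBm hy.2
  obtain ⟨hau, l, hl, hyl⟩ := Amat_spec hgy
  have hAx := (piMap_mul hy hb hbu).2.1
  rw [← hxb] at hAx
  set a := Amat u y with hadef
  have hA : UniFor (permIdx u) (a * b) := hau.mul hu hbu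
  have hgs : ∀ s, UniFor (permIdx u) ((a * b)⁻¹ * lowerScale s a) := fun s =>
    (hA.inv hu).mul hu (hau.lowerScale s)
  have hgU := fun s => (gaussPlus_spec ((hgs s).gauss hu).1).1
  have hcg : Continuous fun s => gaussPlus ((a * b)⁻¹ * lowerScale s a) :=
    continuous_gaussPlus (continuous_const.matrix_mul (continuous_lowerScale a))
      fun s => ((hgs s).gauss hu).1
  have hcm := continuous_inv_of_upperUni hcg hgU
  set m : ℝ → Mat n := fun s => (gaussPlus ((a * b)⁻¹ * lowerScale s a))⁻¹ with hm
  have hmU : ∀ s, upperUni (m s) := fun s => (hgU s).inv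
  let Z : ℝ → Mat n := fun s => y * upperScale s (m s)
  have hZc : Continuous Z := continuous_const.matrix_mul (continuous_upperScale continuous_id hcm)
  have hZ1 : Z 1 = x := by
    have : m 1 = b := by
      simp only [hm, lowerScale_one_left]
      rw [Matrix.mul_inv_rev, Matrix.mul_assoc, Matrix.nonsing_inv_mul _ ha.isUnit, Matrix.mul_one,
        gaussPlus_of_upperUni hb.inv, Matrix.nonsing_inv_nonsing_inv _ hb.isUnit]
    simp only [Z, this, upperScale_one_left]
    exact hxb.symm
  have hZ0 : Z 0 = y := by
    simp only [Z]
    rw [upperScale_zero_left (hmU 0), Matrix.mul_one]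
  have hZw : ∀ s : ℝ, 0 < s → Z s ∈ Ncell w := by
    intro s hs
    refine ⟨hy.1.mul ((hmU s).upperScale s), ?_⟩
    obtain ⟨-, -, p, hp, -, hpe⟩ := (hgs s).gauss hu
    have hD := lowerTriInv_diagonal_pow (n := n) hs.ne'
    have e1 := lowerScale_mul_diagonal ha s
    have e2 := diagonal_mul_upperScale (hmU s) s
    set D : Mat n := Matrix.diagonal (fun i : Fin n => s ^ (i : ℕ))
    have hDU := hD.1
    have e3 : upperScale s (m s) = D⁻¹ * m s * D := by
      rw [Matrix.mul_assoc, ← e2, ← Matrix.mul_assoc, Matrix.nonsing_inv_mul _ hDU, Matrix.one_mul]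
    have e4 : a * D⁻¹ = D⁻¹ * lowerScale s a := by
      have : a = D⁻¹ * lowerScale s a * D := by
        rw [Matrix.mul_assoc, e1, ← Matrix.mul_assoc, Matrix.nonsing_inv_mul _ hDU, Matrix.one_mul]
      conv_lhs => rw [this]
      rw [Matrix.mul_assoc, Matrix.mul_nonsing_inv _ hDU, Matrix.mul_one]
    have e5 : lowerScale s a * m s = a * b * p := by
      have h1 : lowerScale s a = a * b * (p * gaussPlus ((a * b)⁻¹ * lowerScale s a)) := by
        rw [← hpe, ← Matrix.mul_assoc, Matrix.mul_nonsing_inv _ (hA.isUnit hu), Matrix.one_mul]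
      conv_lhs => enter [1]; rw [h1]
      rw [Matrix.mul_assoc, Matrix.mul_assoc p, Matrix.mul_nonsing_inv _ (hgU s).isUnit,
        Matrix.mul_one]
    set E := permMat u * D⁻¹ * permMat u⁻¹ with hE
    have hEl : lowerTriInv E := by
      have hd1 : (permMat u).det * (permMat u⁻¹).det = 1 := by
        rw [← Matrix.det_mul, permMat_mul_inv, Matrix.det_one]
      have hDd : D⁻¹ = Matrix.diagonal (fun i : Fin n => (s ^ (i : ℕ))⁻¹) := by
        refine Matrix.inv_eq_left_inv ?_
        simp only [D, Matrix.diagonal_mul_diagonal]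
        rw [← Matrix.diagonal_one]
        congr 1
        funext i
        exact inv_mul_cancel₀ (pow_ne_zero _ hs.ne')
      refine ⟨?_, fun i j hij => ?_⟩
      · rw [hE, Matrix.det_mul, Matrix.det_mul, mul_right_comm, hd1, one_mul]
        exact Matrix.isUnit_nonsing_inv_det _ hDU
      · rw [hE, mul_permMat_apply, permMat_mul_apply, hDd]
        exact Matrix.diagonal_apply_ne _ fun h => hij.ne (u⁻¹.injective h)
    have e6 : permMat u * D⁻¹ = E * permMat u := by
      rw [hE, Matrix.mul_assoc, permMat_inv_mul, Matrix.mul_one]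
    have e7 : permMat u * (a * b) = l⁻¹ * x := by
      rw [hxb]
      conv_rhs => enter [2, 1]; rw [hyl]
      simp only [Matrix.mul_assoc]
      rw [← Matrix.mul_assoc l⁻¹, Matrix.nonsing_inv_mul _ hl.1, Matrix.one_mul]
    have e8 : Z s = l * E * l⁻¹ * x * (p * D) :=
      calc Z s = l * permMat u * (a * D⁻¹) * m s * D := by
            simp only [Z]
            rw [e3]
            conv_lhs => enter [1]; rw [hyl]
            simp only [Matrix.mul_assoc]
        _ = l * (permMat u * D⁻¹) * (lowerScale s a * m s) * D := by
            rw [e4]; simp only [Matrix.mul_assoc]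
        _ = l * E * (permMat u * (a * b)) * (p * D) := by
            rw [e5, e6]; simp only [Matrix.mul_assoc]
        _ = _ := by rw [e7]; simp only [Matrix.mul_assoc]
    rw [e8]
    exact mul_mem_doubleCosetBm ((hl.mul hEl).mul hl.inv) hxw.2 (hp.triInv.mul hD)
  have hpos : Set.Ioi (0 : ℝ) ⊆ {s | flagNonneg (Z s)} := by
    intro s hs
    have : PreconnectedSpace (Set.Ioi (0 : ℝ)) :=
      Subtype.preconnectedSpace isPreconnected_Ioi
    exact flagNonneg_of_path (w := w) (S := Set.Ioi (0 : ℝ)) (z := fun s => Z s)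
      (hZc.comp continuous_subtype_val) (fun s => hZw s s.2) ⟨1, Set.mem_Ioi.2 one_pos⟩
      (by simpa only [hZ1] using hxf) ⟨s, hs⟩
  have h0 := zero_mem_of_isClosed (isClosed_flagNonneg hZc) hpos
  have h0' : flagNonneg (Z 0) := h0
  rwa [hZ0] at h0'

lemma lowerUni.leading {n k : ℕ} (hk : k ≤ n) {b : Mat n} (hb : lowerUni b) :
    flag b hk (Fin.castLE hk) = 1 := by
  unfold flag
  rw [det_submatrix_blockTriangular negIdx_injective (lowerUni_iff.1 hb).2
    (Fin.castLE_injective hk)]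
  simp [hb.1]

lemma det_vandermonde_pos {k : ℕ} {v : Fin k → ℝ} (hv : StrictMono v) :
    0 < (Matrix.vandermonde v).det := by
  rw [Matrix.det_vandermonde]
  exact Finset.prod_pos fun i _ => Finset.prod_pos fun j hj =>
    sub_pos.2 (hv (Finset.mem_Ioi.1 hj))

/-- There is a lower unitriangular matrix all of whose minors on initial columns are positive. -/
lemma exists_lowerUni_col_pos (n : ℕ) : ∃ p : Mat n, lowerUni p ∧ ∀ (k : ℕ) (hk : k ≤ n)
    (J : Fin k → Fin n), StrictMono J → 0 < (p.submatrix J (Fin.castLE hk)).det := by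
  let V : Mat n := Matrix.of fun i j => ((i : ℕ) : ℝ) ^ (j : ℕ)
  have hV : ∀ (k : ℕ) (hk : k ≤ n) (J : Fin k → Fin n), StrictMono J →
      0 < (V.submatrix J (Fin.castLE hk)).det := by
    intro k hk J hJ
    have e : V.submatrix J (Fin.castLE hk) =
        Matrix.vandermonde fun i => (((J i : Fin n) : ℕ) : ℝ) := by
      ext i j
      simp [V, Matrix.vandermonde_apply]
    rw [e]
    exact det_vandermonde_pos fun i j hij => by exact_mod_cast hJ hij
  have hmono : ∀ (k : ℕ) (hk : k ≤ n), StrictMono (Fin.castLE hk) :=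
    fun k hk => Fin.strictMono_castLE hk
  obtain ⟨a, d, b, ha, hd, hb, hab⟩ :=
    hasGauss_of_leading fun k hk => (hV k hk _ (hmono k hk)).ne'
  have hdb : (d * b).BlockTriangular idx := by
    refine Matrix.BlockTriangular.mul (fun i j hij => hd.2 i j ?_) (upperUni_iff.1 hb).2
    rintro rfl
    exact lt_irrefl _ hij
  have key : ∀ (k : ℕ) (hk : k ≤ n) (J : Fin k → Fin n), (V.submatrix J (Fin.castLE hk)).det =
      (a.submatrix J (Fin.castLE hk)).det * flag (d * b) hk (Fin.castLE hk) := by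
    intro k hk J
    rw [hab, Matrix.mul_assoc, submatrix_mul_upper hk hdb, Matrix.det_mul, flag]
  refine ⟨a, ha, fun k hk J hJ => ?_⟩
  have h1 : 0 < flag (d * b) hk (Fin.castLE hk) := by
    have h2 := hV k hk _ (hmono k hk)
    rw [key] at h2
    have h3 := ha.leading hk
    unfold flag at h3
    rwa [h3, one_mul] at h2
  have h2 := hV k hk J hJ
  rw [key] at h2
  exact (pos_iff_pos_of_mul_pos h2).2 h1

lemma colFlagNonneg.lowerScale {n : ℕ} {q : Mat n} (hq : colFlagNonneg q) (hl : lowerUni q)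
    {s : ℝ} (hs : 0 ≤ s) : colFlagNonneg (lowerScale s q) := by
  intro k hk
  refine ⟨fun J hJ => ?_, ?_⟩
  · have hpos : ∀ s : ℝ, 0 < s →
        0 ≤ ((BruhatTNN.lowerScale s q).submatrix J (Fin.castLE hk)).det := by
      intro s hs
      have e : ((BruhatTNN.lowerScale s q *
          Matrix.diagonal fun i : Fin n => s ^ (i : ℕ)).submatrix J (Fin.castLE hk)).det =
          ((BruhatTNN.lowerScale s q).submatrix J (Fin.castLE hk)).det *
            ∏ i : Fin k, s ^ (i : ℕ) := by
        rw [mul_comm, ← Matrix.det_mul_row]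
        congr 1
        ext i j
        rw [Matrix.submatrix_apply, Matrix.mul_diagonal]
        simp [mul_comm]
      rw [lowerScale_mul_diagonal hl] at e
      have e2 : (((Matrix.diagonal fun i : Fin n => s ^ (i : ℕ)) * q).submatrix J
          (Fin.castLE hk)).det =
          (∏ i : Fin k, s ^ ((J i : Fin n) : ℕ)) * (q.submatrix J (Fin.castLE hk)).det := by
        rw [← Matrix.det_mul_column]
        congr 1
        ext i j
        rw [Matrix.submatrix_apply, Matrix.diagonal_mul]
        simp
      rw [e2] at e
      refine nonneg_of_mul_nonneg_left (b := ∏ i : Fin k, s ^ (i : ℕ)) ?_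
        (Finset.prod_pos fun i _ => pow_pos hs _)
      rw [← e]
      exact mul_nonneg (Finset.prod_nonneg fun i _ => (pow_pos hs _).le) ((hq k hk).1 J hJ)
    rcases hs.eq_or_lt with rfl | hs
    · have hc : Continuous fun s : ℝ =>
          ((BruhatTNN.lowerScale s q).submatrix J (Fin.castLE hk)).det :=
        ((continuous_lowerScale q).matrix_submatrix _ _).matrix_det
      exact zero_mem_of_isClosed (C := {s : ℝ |
        0 ≤ ((BruhatTNN.lowerScale s q).submatrix J (Fin.castLE hk)).det})
        (isClosed_le continuous_const hc) fun s hs => hpos s hs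
    · exact hpos s hs
  · rw [(hl.lowerScale s).leading hk]; exact one_pos

/-- Any two lower unitriangular matrices can be translated on the right into the
totally nonnegative part. -/
lemma exists_colFlagNonneg_mul {n : ℕ} {q q' : Mat n} (hq : lowerUni q) (hq' : lowerUni q') :
    ∃ r, lowerUni r ∧ colFlagNonneg (q * r) ∧ colFlagNonneg (q' * r) := by
  obtain ⟨p, hp, hpos⟩ := exists_lowerUni_col_pos n
  have ev : ∀ {q : Mat n}, lowerUni q → ∀ᶠ s in nhds (0 : ℝ),
      ∀ t : Σ k : Fin (n + 1), (Fin (k : ℕ) → Fin n), StrictMono t.2 →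
        0 < ((lowerScale s q * p).submatrix t.2 (Fin.castLE (Nat.lt_succ_iff.1 t.1.2))).det := by
    intro q hq
    refine Filter.eventually_all.2 fun t => ?_
    by_cases ht : StrictMono t.2
    · have hc : Continuous fun s : ℝ =>
          ((lowerScale s q * p).submatrix t.2 (Fin.castLE (Nat.lt_succ_iff.1 t.1.2))).det :=
        (((continuous_lowerScale q).matrix_mul continuous_const).matrix_submatrix _ _).matrix_det
      have h0 : 0 < ((lowerScale 0 q * p).submatrix t.2
          (Fin.castLE (Nat.lt_succ_iff.1 t.1.2))).det := by
        rw [lowerScale_zero_left hq, Matrix.one_mul]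
        exact hpos _ _ _ ht
      exact ((hc.tendsto 0).eventually_const_lt h0).mono fun s hs _ => hs
    · exact Filter.Eventually.of_forall fun s h => absurd h ht
  have hev := ((ev hq).and (ev hq')).filter_mono (nhdsWithin_le_nhds (s := Set.Ioi 0))
  obtain ⟨s, ⟨h1, h2⟩, hs⟩ := (hev.and self_mem_nhdsWithin).exists
  replace hs : 0 < s := hs
  refine ⟨lowerScale s⁻¹ p, hp.lowerScale _, ?_⟩
  have key : ∀ {q : Mat n}, lowerUni q →
      (∀ t : Σ k : Fin (n + 1), (Fin (k : ℕ) → Fin n), StrictMono t.2 →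
        0 < ((lowerScale s q * p).submatrix t.2 (Fin.castLE (Nat.lt_succ_iff.1 t.1.2))).det) →
      colFlagNonneg (q * lowerScale s⁻¹ p) := by
    intro q hq h
    have e : q * lowerScale s⁻¹ p = lowerScale s⁻¹ (lowerScale s q * p) := by
      rw [lowerScale_mul (hq.lowerScale s) hp, lowerScale_lowerScale, inv_mul_cancel₀ hs.ne',
        lowerScale_one_left]
    rw [e]
    have hl := (hq.lowerScale s).mul hp
    refine colFlagNonneg.lowerScale (fun k hk => ⟨fun J hJ => ?_, ?_⟩) hl (inv_nonneg.2 hs.le)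
    · exact (h ⟨⟨k, Nat.lt_succ_iff.2 hk⟩, J⟩ hJ).le
    · rw [hl.leading hk]; exact one_pos
  exact ⟨key hq h1, key hq' h2⟩

/-- Moving the base point inside the cell of `u` towards `[u r]_+` does not change the total
nonnegativity of the projection. -/
lemma flagNonneg_rhoFormula_iff {n : ℕ} {u w : Equiv.Perm (Fin n)} {x y r : Mat n}
    (hg : hasGauss (x * permMat u⁻¹)) (hx : x ∈ doubleCosetBm w) (hy : y ∈ Ncell u)
    (hyf : flagNonneg y) (hr : lowerUni r) (hc : colFlagNonneg ((Amat u y)⁻¹ * r)) :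
    flagNonneg (rhoFormula u y x) ↔ flagNonneg (rhoFormula u (gaussPlus (permMat u * r)) x) := by
  have hu := permIdx_injective u
  obtain ⟨hgy, ha⟩ := Amat_of_mem_doubleCosetBm hy.2
  obtain ⟨hau, l, hl, hyl⟩ := Amat_spec hgy
  set a := Amat u y
  have hq : lowerUni (a⁻¹ * r) := ha.inv.mul hr
  let I := Set.Icc (0 : ℝ) 1
  have : PreconnectedSpace I := Subtype.preconnectedSpace isPreconnected_Icc
  let Y : I → Mat n := fun s => gaussPlus (y * lowerScale s (a⁻¹ * r))
  have hGY : ∀ s : I, hasGauss (y * lowerScale s (a⁻¹ * r)) := fun s =>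
    hasGauss_mul_of_flagNonneg hy.1 hyf (hc.lowerScale hq s.2.1)
  have hYu : ∀ s, Y s ∈ Ncell u := fun s =>
    gaussPlus_mem_Ncell hy.2 (hq.lowerScale s).triInv (hGY s)
  have hYc : Continuous Y := continuous_gaussPlus
    (continuous_const.matrix_mul ((continuous_lowerScale _).comp continuous_subtype_val)) hGY
  have hAc : Continuous fun s => Amat u (Y s) := by
    unfold Amat
    exact (continuous_const.matrix_mul (continuous_gaussPlus
      (hYc.matrix_mul continuous_const)
      fun s => (Amat_of_mem_doubleCosetBm (hYu s).2).1)).matrix_mul continuous_const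
  have hZc : Continuous fun s => rhoFormula u (Y s) x := by
    unfold rhoFormula
    refine hYc.matrix_mul (continuous_inv_of_upperUni (continuous_gaussPlus
      (continuous_const.matrix_mul hAc) fun s => (rhoFormula_factor hg (hYu s)).1) fun s => ?_)
    exact (gaussPlus_spec (rhoFormula_factor hg (hYu s)).1).1
  have hZw : ∀ s, rhoFormula u (Y s) x ∈ Ncell w := fun s => rhoFormula_mem_Ncell hg (hYu s) hx
  have h01 : (0 : ℝ) ∈ I := ⟨le_rfl, zero_le_one⟩
  have h11 : (1 : ℝ) ∈ I := ⟨zero_le_one, le_rfl⟩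
  have hY0 : Y ⟨0, h01⟩ = y := by
    simp only [Y]
    rw [lowerScale_zero_left hq, Matrix.mul_one, gaussPlus_of_upperUni hy.1]
  have hY1 : Y ⟨1, h11⟩ = gaussPlus (permMat u * r) := by
    have e : y * (a⁻¹ * r) = l * (permMat u * r) := by
      conv_lhs => rw [hyl]
      rw [Matrix.mul_assoc, ← Matrix.mul_assoc a, Matrix.mul_nonsing_inv _ ha.isUnit,
        Matrix.one_mul, Matrix.mul_assoc]
    have hG := hGY ⟨1, h11⟩
    simp only [Y]
    simp only [lowerScale_one_left] at hG ⊢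
    have e' : permMat u * r = l⁻¹ * (y * (a⁻¹ * r)) := by
      rw [e, ← Matrix.mul_assoc, Matrix.nonsing_inv_mul _ hl.1, Matrix.one_mul]
    rw [e', gaussPlus_lower_mul hl.inv hG]
  constructor
  · intro h
    have := flagNonneg_of_path hZc hZw ⟨0, h01⟩ (by rw [hY0]; exact h) ⟨1, h11⟩
    rwa [hY1] at this
  · intro h
    have := flagNonneg_of_path hZc hZw ⟨1, h11⟩ (by rw [hY1]; exact h) ⟨0, h01⟩
    rwa [hY0] at this

/-- The projection `ρ_y` preserves each totally nonnegative cell. -/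
lemma rho_mem_Ycirc {n : ℕ} {u w : Equiv.Perm (Fin n)} {x y : Mat n} (huw : bruhatLE u w)
    (hx : x ∈ Ycirc w) (hy : y ∈ Ycirc u) : rhoFormula u y x ∈ Ycirc w := by
  have hg := hasGauss_mul_permMat_inv huw hx
  obtain ⟨hxw, hxf⟩ := Ycirc_iff.1 hx
  obtain ⟨hyu, hyf⟩ := Ycirc_iff.1 hy
  refine Ycirc_iff.2 ⟨rhoFormula_mem_Ncell hg hyu hxw.2, ?_⟩
  obtain ⟨b, hb, hbu, hpu, -⟩ := piMap_spec hx.1 hg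
  obtain ⟨r, hr, h1, h2⟩ := exists_colFlagNonneg_mul
    (Amat_of_mem_doubleCosetBm hyu.2).2.inv (Amat_of_mem_doubleCosetBm hpu.2).2.inv
  rw [flagNonneg_rhoFormula_iff hg hxw.2 hyu hyf hr h1,
    ← flagNonneg_rhoFormula_iff hg hxw.2 hpu (flagNonneg_piMap huw hx) hr h2,
    rhoFormula_piMap hx.1 hg]
  exact hxf

end

theorem statement13 (n : ℕ) (hn : 1 ≤ n) (u : Equiv.Perm (Fin n))
    (xu txu : Mat n) (hxu : xu ∈ Ycirc u) (htxu : txu ∈ Ycirc u) :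
    (∀ x ∈ Yge u,
      (∃ nm ∈ Nminus u, hasGauss (x * nm) ∧ rho u xu x = gaussPlus (x * nm)) ∧
      (∃ m ∈ Ngrp u, rho u xu x = xu * m) ∧
      totNonneg (rho u xu x)) ∧
    Set.BijOn (rho u xu)
      {x | x ∈ Yge u ∧ piMap u x = txu} {x | x ∈ Yge u ∧ piMap u x = xu} ∧
    (∀ w : Equiv.Perm (Fin n), bruhatLE u w →
      Set.BijOn (rho u xu)
        (Ycirc w ∩ {x | x ∈ Yge u ∧ piMap u x = txu})
        (Ycirc w ∩ {x | x ∈ Yge u ∧ piMap u x = xu})) := by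
  have hxuN := (Ycirc_iff.1 hxu).1
  have htxuN := (Ycirc_iff.1 htxu).1
  have good : ∀ {x}, x ∈ Yge u → hasGauss (x * permMat u⁻¹) := by
    rintro x ⟨v, huv, hx⟩
    exact hasGauss_mul_permMat_inv huv hx
  have upper : ∀ {x}, x ∈ Yge u → upperUni x := by
    rintro x ⟨v, -, hx⟩
    exact hx.1
  have maps : ∀ {y y' x w}, y ∈ Ycirc u → bruhatLE u w →
      x ∈ Ycirc w ∩ {x | x ∈ Yge u ∧ piMap u x = y'} →
      rho u y x ∈ Ycirc w ∩ {x | x ∈ Yge u ∧ piMap u x = y} := by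
    rintro y y' x w hy huw ⟨hx, hxY, -⟩
    have hyN := (Ycirc_iff.1 hy).1
    rw [(rho_spec (good hxY) hyN).1]
    have h := rho_mem_Ycirc huw hx hy
    exact ⟨h, ⟨w, huw, h⟩, (piMap_rhoFormula (good hxY) hyN).2⟩
  have inv : ∀ {y y' x}, y ∈ Ycirc u → y' ∈ Ycirc u → x ∈ Yge u → piMap u x = y' →
      rho u y' (rho u y x) = x := by
    rintro y y' x hy hy' hxY rfl
    have hyN := (Ycirc_iff.1 hy).1
    rw [(rho_spec (good hxY) hyN).1,
      (rho_spec (piMap_rhoFormula (good hxY) hyN).1 (Ycirc_iff.1 hy').1).1]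
    exact rhoFormula_rhoFormula (upper hxY) (good hxY) hyN
  have fiber : ∀ {y y' x}, y ∈ Ycirc u → x ∈ {x | x ∈ Yge u ∧ piMap u x = y'} →
      rho u y x ∈ {x | x ∈ Yge u ∧ piMap u x = y} := by
    rintro y y' x hy ⟨⟨w, huw, hx⟩, hp⟩
    exact (maps hy huw ⟨hx, ⟨w, huw, hx⟩, hp⟩).2
  refine ⟨fun x hx => ?_, ?_, fun w huw => ?_⟩
  · have hs := rho_spec (good hx) hxuN
    refine ⟨hs.2, ?_, ?_⟩
    · obtain ⟨-, nm, m, -, hm, hmg, -⟩ := rhoFormula_factor (good hx) hxuN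
      exact ⟨m, hm, by rw [hs.1, hmg, rhoFormula]⟩
    · obtain ⟨w, huw, hxw⟩ := hx
      exact (maps hxu huw ⟨hxw, ⟨w, huw, hxw⟩, rfl⟩).1.2.1
  · exact Set.InvOn.bijOn (f' := rho u txu)
      ⟨fun x hx => inv hxu htxu hx.1 hx.2, fun x hx => inv htxu hxu hx.1 hx.2⟩
      (fun x hx => fiber hxu hx) fun x hx => fiber htxu hx
  · exact Set.InvOn.bijOn (f' := rho u txu)
      ⟨fun x hx => inv hxu htxu hx.2.1 hx.2.2, fun x hx => inv htxu hxu hx.2.1 hx.2.2⟩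
      (fun x hx => maps hxu huw hx) fun x hx => maps htxu huw hx

end BruhatTNN
end

section
/- Let f, f_-, f_+ : ℝ → M_n(ℝ) be matrix-valued functions, each differentiable at τ = 1, such that for all τ > 0 one has f(τ) = f_-(τ) f_+(τ) with f_-(τ) lower triangular and f_+(τ) upper unitriangular, and such that f(1) is the identity matrix. Then f_+'(1) = π_n(f'(1)), where π_n(M) denotes the matrix obtained from M by replacing every entry on or below the main diagonal by zero (the projection onto strictly upper triangular matrices along lower triangular matrices). -/
open scoped Classical

namespace BruhatTNN

/-- A lower triangular matrix times an upper unitriangular matrix is the identity only if both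
factors are the identity. -/
theorem eq_one_of_lower_mul_upperUni_eq_one {n : ℕ} {L U : Mat n}
    (hL : ∀ i j : Fin n, i < j → L i j = 0) (hU : upperUni U) (h : L * U = 1) :
    L = 1 ∧ U = 1 := by
  have hUtri : Matrix.BlockTriangular U id := fun i j hij => hU.2 i j hij
  have hLtri : Matrix.BlockTriangular L id := by
    let _ : Invertible U := ⟨L, h, mul_eq_one_comm.mp h⟩
    rw [← Matrix.inv_eq_left_inv h]
    exact Matrix.blockTriangular_inv_of_blockTriangular hUtri
  have hdiag : ∀ i j : Fin n, i ≠ j → L i j = 0 := fun i j hij =>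
    hij.lt_or_gt.elim (hL i j) fun hji => hLtri hji
  have hentry : ∀ i j : Fin n, L i i * U i j = (1 : Mat n) i j := fun i j => by
    rw [← h, Matrix.mul_apply, Finset.sum_eq_single i]
    · intro k _ hk
      rw [hdiag i k hk.symm, zero_mul]
    · simp
  have hL1 : L = 1 := by
    ext i j
    by_cases hij : i = j
    · subst hij
      simpa [hU.1 i] using hentry i i
    · rw [hdiag i j hij, Matrix.one_apply_ne hij]
  exact ⟨hL1, by simpa [hL1] using h⟩

theorem statement15 (n : ℕ) (hn : 1 ≤ n) (f fm fp : ℝ → Mat n)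
    (hf : ∀ i j : Fin n, DifferentiableAt ℝ (fun τ => f τ i j) 1)
    (hfm : ∀ i j : Fin n, DifferentiableAt ℝ (fun τ => fm τ i j) 1)
    (hfp : ∀ i j : Fin n, DifferentiableAt ℝ (fun τ => fp τ i j) 1)
    (hfac : ∀ τ : ℝ, 0 < τ → f τ = fm τ * fp τ)
    (hlow : ∀ τ : ℝ, 0 < τ → ∀ i j : Fin n, i < j → fm τ i j = 0)
    (hup : ∀ τ : ℝ, 0 < τ → upperUni (fp τ))
    (hf1 : f 1 = 1) :
    ∀ i j : Fin n,
      deriv (fun τ => fp τ i j) 1 =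
        if i < j then deriv (fun τ => f τ i j) 1 else 0 := by
  have hfac1 : fm 1 * fp 1 = 1 := (hfac 1 one_pos).symm.trans hf1
  obtain ⟨hm1, hp1⟩ :=
    eq_one_of_lower_mul_upperUni_eq_one (hlow 1 one_pos) (hup 1 one_pos) hfac1
  have hpos : ∀ᶠ τ : ℝ in nhds 1, 0 < τ := lt_mem_nhds one_pos
  intro i j
  split_ifs with hij
  · have hderiv : deriv (fun τ => f τ i j) 1 =
        deriv (fun τ => fm τ i j) 1 + deriv (fun τ => fp τ i j) 1 := by
      have hsum := HasDerivAt.fun_sum (u := Finset.univ) fun k _ =>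
        (hfm i k).hasDerivAt.fun_mul (hfp k j).hasDerivAt
      have heq : (fun τ => f τ i j) =ᶠ[nhds 1] fun τ => ∑ k, fm τ i k * fp τ k j :=
        hpos.mono fun τ hτ => by simp only [hfac τ hτ, Matrix.mul_apply]
      rw [(hsum.congr_of_eventuallyEq heq).deriv]
      simp [hm1, hp1, Matrix.one_apply, Finset.sum_add_distrib]
    have hm : deriv (fun τ => fm τ i j) 1 = 0 := by
      have heq : (fun τ => fm τ i j) =ᶠ[nhds 1] fun _ => 0 :=
        hpos.mono fun τ hτ => hlow τ hτ i j hij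
      rw [heq.deriv_eq, deriv_const]
    rw [hderiv, hm, zero_add]
  · have heq : (fun τ => fp τ i j) =ᶠ[nhds 1] fun _ => if i = j then 1 else 0 :=
      hpos.mono fun τ hτ => by
        by_cases h : i = j
        · subst h
          simpa using (hup τ hτ).1 i
        · simpa [h] using (hup τ hτ).2 i j (lt_of_le_of_ne (not_lt.mp hij) (Ne.symm h))
    rw [heq.deriv_eq, deriv_const]

end BruhatTNN
end
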